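/- arXiv:1601.03424 — 3 statements merged into one kernel-verified Lean document; each statement's English description precedes it below -/
import Mathlib

section
/- Let F be a field and let P ∈ F[X] be a separable irreducible polynomial none of whose roots in an algebraic closure of F is zero or a root of unity. Suppose that for every root a of P in an algebraic closure of F, the element a is rootless modtor in the field F(a). Then P has good heredity over F. -/
open Polynomial

/-- `a` is a root of unity, i.e. a torsion element of the multiplicative monoid. -/
def IsRootOfUnityElem {F : Type*} [Monoid F] (a : F) : Prop := ∃ n : ℕ, 0 < n ∧ a ^ n = 1

/-- `P` is hereditarily irreducible over `F`: `P(X^n)` is irreducible for every `n ≥ 1`. -/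
def HeredIrreducible {F : Type*} [Field F] (P : F[X]) : Prop :=
  ∀ n : ℕ, 0 < n → Irreducible (P.comp (X ^ n))

/-- `P` has good heredity over `F`: some `P(X^n)` is a product of hereditarily
irreducible polynomials. -/
def HasGoodHeredity {F : Type*} [Field F] (P : F[X]) : Prop :=
  ∃ n : ℕ, 0 < n ∧ ∃ l : Multiset F[X],
    (∀ Q ∈ l, HeredIrreducible Q) ∧ P.comp (X ^ n) = l.prod

/-- `a` is rootless in `F`: only finitely many positive `n` admit a solution of `x^n = a`. -/
def RootlessElem {F : Type*} [Field F] (a : F) : Prop :=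
  {n : ℕ | 0 < n ∧ ∃ x : F, x ^ n = a}.Finite

/-- `a` is rootless modtor in `F`: only finitely many positive `n` admit a root of unity `ζ`
and `g` with `g^n = ζ * a`. -/
def RootlessModtorElem {F : Type*} [Field F] (a : F) : Prop :=
  {n : ℕ | 0 < n ∧ ∃ ζ g : F, IsRootOfUnityElem ζ ∧ g ^ n = ζ * a}.Finite

/-- `a` is very rootless: it is not a proper power. -/
def VeryRootless {F : Type*} [Field F] (a : F) : Prop :=
  ¬ ∃ (g : F) (n : ℕ), 2 ≤ n ∧ a = g ^ n

/-- `a` is very rootless modtor: it is not a proper power times a root of unity. -/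
def VeryRootlessModtor {F : Type*} [Field F] (a : F) : Prop :=
  ¬ ∃ (ζ g : F) (n : ℕ), IsRootOfUnityElem ζ ∧ 2 ≤ n ∧ a = ζ * g ^ n

/-- A field is rootless if all its elements that are neither zero nor roots of unity are. -/
def RootlessField (F : Type*) [Field F] : Prop :=
  ∀ a : F, a ≠ 0 → ¬ IsRootOfUnityElem a → RootlessElem a

/-- A field is rootless modtor if all its elements that are neither zero nor
roots of unity are. -/
def RootlessModtorField (F : Type*) [Field F] : Prop :=
  ∀ a : F, a ≠ 0 → ¬ IsRootOfUnityElem a → RootlessModtorElem a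

/-- A field has good heredity if every polynomial none of whose roots in an algebraic
closure is zero or a root of unity has good heredity. -/
def GoodHeredityField (F : Type*) [Field F] : Prop :=
  ∀ P : F[X],
    (∀ b : AlgebraicClosure F, Polynomial.aeval b P = 0 → b ≠ 0 ∧ ¬ IsRootOfUnityElem b) →
    HasGoodHeredity P

namespace IsRootOfUnityElem

theorem one {M : Type*} [Monoid M] : IsRootOfUnityElem (1 : M) := ⟨1, one_pos, one_pow 1⟩

theorem mul {M : Type*} [CommMonoid M] {x y : M} (hx : IsRootOfUnityElem x)
    (hy : IsRootOfUnityElem y) : IsRootOfUnityElem (x * y) := by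
  obtain ⟨m, hm, hx⟩ := hx
  obtain ⟨n, hn, hy⟩ := hy
  exact ⟨m * n, Nat.mul_pos hm hn, by rw [mul_pow, pow_mul, hx, mul_comm m, pow_mul, hy]; simp⟩

theorem pow {M : Type*} [Monoid M] {x : M} (hx : IsRootOfUnityElem x) (k : ℕ) :
    IsRootOfUnityElem (x ^ k) := by
  obtain ⟨m, hm, hx⟩ := hx
  exact ⟨m, hm, by rw [← pow_mul, mul_comm, pow_mul, hx, one_pow]⟩

theorem of_pow {M : Type*} [Monoid M] {x : M} {k : ℕ} (hk : 0 < k)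
    (hx : IsRootOfUnityElem (x ^ k)) : IsRootOfUnityElem x := by
  obtain ⟨m, hm, hx⟩ := hx
  exact ⟨k * m, Nat.mul_pos hk hm, by rw [pow_mul, hx]⟩

theorem inv {M : Type*} [DivisionMonoid M] {x : M} (hx : IsRootOfUnityElem x) :
    IsRootOfUnityElem x⁻¹ := by
  obtain ⟨m, hm, hx⟩ := hx
  exact ⟨m, hm, by rw [inv_pow, hx, inv_one]⟩

theorem zpow {M : Type*} [DivisionMonoid M] {x : M} (hx : IsRootOfUnityElem x) (k : ℤ) :
    IsRootOfUnityElem (x ^ k) := by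
  obtain ⟨m, hm, hx⟩ := hx
  exact ⟨m, hm, by rw [← zpow_natCast, ← zpow_mul, mul_comm, zpow_mul, zpow_natCast, hx, one_zpow]⟩

theorem map {M N G : Type*} [Monoid M] [Monoid N] [FunLike G M N] [MonoidHomClass G M N] (f : G)
    {x : M} (hx : IsRootOfUnityElem x) : IsRootOfUnityElem (f x) := by
  obtain ⟨m, hm, hx⟩ := hx
  exact ⟨m, hm, by rw [← map_pow, hx, map_one]⟩

theorem of_map {M N G : Type*} [Monoid M] [Monoid N] [FunLike G M N] [MonoidHomClass G M N]
    {f : G} (hf : Function.Injective f) {x : M} (hx : IsRootOfUnityElem (f x)) :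
    IsRootOfUnityElem x := by
  obtain ⟨m, hm, hx⟩ := hx
  exact ⟨m, hm, hf (by rw [map_pow, hx, map_one])⟩

theorem ne_zero {F : Type*} [Field F] {x : F} (hx : IsRootOfUnityElem x) : x ≠ 0 := by
  obtain ⟨m, hm, hx⟩ := hx
  rintro rfl
  rw [zero_pow hm.ne'] at hx
  exact zero_ne_one hx

theorem neg_one {F : Type*} [Field F] : IsRootOfUnityElem (-1 : F) := ⟨2, two_pos, by simp⟩

end IsRootOfUnityElem

/-- An automorphism of a field acts on the roots of unity of bounded order by a power map. -/
theorem exists_zpow_of_pow_eq_one {M : Type*} [Field M] (σ : M ≃+* M) {m : ℕ} (hm : 0 < m) :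
    ∃ i : ℤ, ∀ x : M, x ^ m = 1 → σ x = x ^ i := by
  have : NeZero m := ⟨hm.ne'⟩
  obtain ⟨i, hi⟩ := MonoidHom.map_cyclic (restrictRootsOfUnity σ m)
  refine ⟨i, fun x hx => ?_⟩
  have h := congrArg (fun y : rootsOfUnity m M => ((y : Mˣ) : M)) (hi (rootsOfUnity.mkOfPowEq x hx))
  simpa using h

/-- If `h` generates a Kummer-type radical of `p`-power exponent inside an abelian extension, then
the base field contains the corresponding roots of unity. -/
theorem mem_bot_of_pow_eq_mul_of_commute {L M : Type*} [Field L] [Field M] [Algebra L M]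
    [IsGalois L M] (hcomm : ∀ σ τ : M ≃ₐ[L] M, ∀ x, σ (τ x) = τ (σ x)) {p j : ℕ} (hp : p.Prime)
    {g : L} (hg0 : g ≠ 0) (hg : ∀ k ζ : L, IsRootOfUnityElem ζ → k ^ p ≠ ζ * g) {h ξ : M}
    (hξ : IsRootOfUnityElem ξ) (hh : h ^ p ^ j = ξ * algebraMap L M g) {x : M}
    (hx : x ^ p ^ j = 1) : x ∈ (⊥ : IntermediateField L M) := by
  have hgM : algebraMap L M g ≠ 0 := by simpa using hg0
  have hpj : 0 < p ^ j := pow_pos hp.pos j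
  have hh0 : h ≠ 0 := by
    rintro rfl
    rw [zero_pow hpj.ne'] at hh
    exact mul_ne_zero hξ.ne_zero hgM hh.symm
  rw [InfiniteGalois.mem_bot_iff_fixed]
  intro τ
  obtain ⟨w, hw, hξw⟩ := hξ
  have hε : ∀ σ : M ≃ₐ[L] M, (σ h / h) ^ (p ^ j * w) = 1 := by
    intro σ
    rw [pow_mul, div_pow, ← map_pow, hh, map_mul, AlgEquiv.commutes, mul_div_mul_right _ _ hgM,
      div_pow, ← map_pow, hξw, map_one, div_one]
  obtain ⟨i, hi⟩ := exists_zpow_of_pow_eq_one (τ : M ≃+* M) (Nat.mul_pos hpj hw)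
  have hi' : ∀ x : M, x ^ (p ^ j * w) = 1 → τ x = x ^ i := hi
  have hd : τ h * h ^ (-i) ∈ (⊥ : IntermediateField L M) := by
    rw [InfiniteGalois.mem_bot_iff_fixed]
    intro σ
    obtain ⟨ε, hε1⟩ : ∃ ε, ε = σ h / h := ⟨_, rfl⟩
    have hσ : σ h = ε * h := by rw [hε1]; field_simp
    have hε0 : ε ≠ 0 := by rw [hε1]; simpa using hh0
    have := hi' ε (hε1 ▸ hε σ)
    rw [map_mul, map_zpow₀, hcomm σ τ, hσ, map_mul, this, mul_zpow, zpow_neg ε]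
    have := zpow_ne_zero i hε0
    field_simp
  obtain ⟨d, hd⟩ := IntermediateField.mem_bot.mp hd
  have hpow : h ^ (i - 1) = (τ h / h) * (algebraMap L M d)⁻¹ := by
    have hτ : τ h ≠ 0 := by simpa using hh0
    rw [hd, zpow_neg, zpow_sub_one₀ hh0]
    have := zpow_ne_zero i hh0
    field_simp
  have hdvd : ((p ^ j : ℕ) : ℤ) ∣ i - 1 := by
    by_contra hnd
    have hgcd : Int.gcd ((p ^ j : ℕ) : ℤ) (i - 1) ∣ p ^ j := by
      exact_mod_cast Int.gcd_dvd_left ((p ^ j : ℕ) : ℤ) (i - 1)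
    obtain ⟨s, hs, hs'⟩ := (Nat.dvd_prime_pow hp).mp hgcd
    have hsj : s < j := by
      refine lt_of_le_of_ne hs ?_
      rintro rfl
      apply hnd
      rw [← hs']
      exact Int.gcd_dvd_right _ _
    have hbez := Int.gcd_eq_gcd_ab ((p ^ j : ℕ) : ℤ) (i - 1)
    set α := Int.gcdA ((p ^ j : ℕ) : ℤ) (i - 1)
    set β := Int.gcdB ((p ^ j : ℕ) : ℤ) (i - 1)
    obtain ⟨ρ, hρdef⟩ : ∃ ρ, ρ = ξ ^ α * (τ h / h) ^ β := ⟨_, rfl⟩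
    have hρ : IsRootOfUnityElem ρ := by
      rw [hρdef]
      exact (IsRootOfUnityElem.zpow ⟨w, hw, hξw⟩ _).mul
        (IsRootOfUnityElem.zpow ⟨_, Nat.mul_pos hpj hw, hε τ⟩ _)
    have hs1 : h ^ p ^ s = ρ * algebraMap L M (g ^ α * d⁻¹ ^ β) := by
      rw [← zpow_natCast h (p ^ s), ← hs', hbez, zpow_add₀ hh0, zpow_mul, zpow_mul, zpow_natCast,
        hh, hpow, hρdef, mul_zpow, mul_zpow]
      simp only [map_mul, map_zpow₀, map_inv₀]
      ring
    set k := g ^ α * d⁻¹ ^ β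
    have hk : algebraMap L M ((k ^ p ^ (j - s - 1)) ^ p) =
        ρ⁻¹ ^ p ^ (j - s) * ξ * algebraMap L M g := by
      rw [mul_assoc, ← hh]
      have e1 : p ^ j = p ^ s * p ^ (j - s) := by rw [← pow_add]; congr 1; omega
      have e2 : p ^ (j - s - 1) * p = p ^ (j - s) := by rw [← pow_succ]; congr 1; omega
      rw [e1, pow_mul, hs1, ← mul_pow, inv_mul_cancel_left₀ hρ.ne_zero, ← pow_mul, e2, map_pow]
    refine hg (k ^ p ^ (j - s - 1)) ((k ^ p ^ (j - s - 1)) ^ p / g) ?_ (by field_simp)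
    refine IsRootOfUnityElem.of_map (f := algebraMap L M) (algebraMap L M).injective ?_
    rw [map_div₀, hk, mul_div_cancel_right₀ _ hgM]
    exact (hρ.inv.pow _).mul ⟨w, hw, hξw⟩
  obtain ⟨c, hc⟩ := hdvd
  have hx0 : x ≠ 0 := IsRootOfUnityElem.ne_zero ⟨_, hpj, hx⟩
  rw [hi' x (by rw [pow_mul, hx, one_pow]), show i = (p ^ j : ℕ) * c + 1 by omega,
    zpow_add_one₀ hx0, zpow_mul, zpow_natCast, hx, one_zpow, one_mul]

/-- An element that becomes an `n`-th power modulo torsion in an extension of degree `d` is an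
`n / gcd(n, d)`-th power modulo torsion in the base. -/
theorem exists_pow_eq_mul_of_finiteDimensional {L M : Type*} [Field L] [Field M] [Algebra L M]
    [FiniteDimensional L M] {a : L} (ha : a ≠ 0) {n : ℕ} (hn : 0 < n) {h ξ : M}
    (hξ : IsRootOfUnityElem ξ) (hh : h ^ n = ξ * algebraMap L M a) :
    ∃ k ζ : L, IsRootOfUnityElem ζ ∧ k ^ (n / n.gcd (Module.finrank L M)) = ζ * a := by
  have hg := Nat.gcd_pos_of_pos_left (Module.finrank L M) hn
  have hN := congrArg (Algebra.norm L) hh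
  rw [map_pow, map_mul, Algebra.norm_algebraMap] at hN
  set e := Algebra.norm L h
  set d := Module.finrank L M
  set n₁ := n / n.gcd d
  set d₁ := d / n.gcd d
  have hcop : Nat.Coprime n₁ d₁ := Nat.coprime_div_gcd_div_gcd hg
  have e1 : n = n₁ * n.gcd d := (Nat.div_mul_cancel (Nat.gcd_dvd_left _ _)).symm
  have e2 : d = d₁ * n.gcd d := (Nat.div_mul_cancel (Nat.gcd_dvd_right _ _)).symm
  have had : a ^ d₁ ≠ 0 := pow_ne_zero _ ha
  obtain ⟨ζ, hζ'⟩ : ∃ ζ, ζ = e ^ n₁ / a ^ d₁ := ⟨_, rfl⟩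
  have hζ : IsRootOfUnityElem ζ := by
    refine IsRootOfUnityElem.of_pow (k := n.gcd d) hg ?_
    rw [hζ', div_pow, ← pow_mul, ← pow_mul, ← e1, ← e2, hN,
      mul_div_cancel_right₀ _ (pow_ne_zero _ ha)]
    exact hξ.map _
  have he : e ^ n₁ = ζ * a ^ d₁ := by rw [hζ']; field_simp
  have he0 : e ≠ 0 := by
    have : h ≠ 0 := by
      rintro rfl
      rw [zero_pow hn.ne'] at hh
      exact mul_ne_zero hξ.ne_zero (by simpa using ha) hh.symm
    exact Algebra.norm_ne_zero_iff.mpr this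
  have hbez := Nat.gcd_eq_gcd_ab n₁ d₁
  rw [hcop.gcd_eq_one] at hbez
  set α := Nat.gcdA n₁ d₁
  set β := Nat.gcdB n₁ d₁
  refine ⟨a ^ α * e ^ β, ζ ^ β, hζ.zpow _, ?_⟩
  have h1 : (a ^ α * e ^ β) ^ n₁ = a ^ (α * n₁) * (e ^ n₁) ^ β := by
    rw [mul_pow, zpow_mul, zpow_natCast, ← zpow_natCast (e ^ β), ← zpow_mul, ← zpow_natCast e n₁,
      ← zpow_mul, mul_comm β]
  have h2 : (a ^ d₁) ^ β = a ^ (d₁ * β) := by rw [zpow_mul, zpow_natCast]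
  rw [h1, he, mul_zpow, h2, mul_left_comm, ← zpow_add₀ ha, mul_comm α, ← hbez, Nat.cast_one, zpow_one]

/-- The extension of `K` inside `Ω` generated by the `m`-th roots of unity. -/
def cyclotomicSubfield (K : Type*) {Ω : Type*} [Field K] [Field Ω] [Algebra K Ω] (m : ℕ) :
    IntermediateField K Ω :=
  IntermediateField.adjoin K {x : Ω | x ^ m = 1}

theorem mem_cyclotomicSubfield {K Ω : Type*} [Field K] [Field Ω] [Algebra K Ω] {m : ℕ} {x : Ω}
    (hx : x ^ m = 1) : x ∈ cyclotomicSubfield K m :=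
  IntermediateField.subset_adjoin K _ hx

theorem cyclotomicSubfield_mono {K Ω : Type*} [Field K] [Field Ω] [Algebra K Ω] {m n : ℕ}
    (h : m ∣ n) : (cyclotomicSubfield K m : IntermediateField K Ω) ≤ cyclotomicSubfield K n := by
  obtain ⟨c, rfl⟩ := h
  exact IntermediateField.adjoin.mono K _ _ fun x (hx : x ^ m = 1) => by
    simp [pow_mul, hx]

theorem isSeparable_of_pow_eq_one {K Ω : Type*} [Field K] [Field Ω] [Algebra K Ω] {m : ℕ}
    (hm : 0 < m) {x : Ω} (hx : x ^ m = 1) : IsSeparable K x := by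
  suffices ∃ n : ℕ, (n : K) ≠ 0 ∧ x ^ n = 1 by
    obtain ⟨n, hn, hxn⟩ := this
    exact (X_pow_sub_one_separable_iff.mpr hn).of_dvd (minpoly.dvd K x (by simp [hxn]))
  obtain ⟨p, hp⟩ := CharP.exists K
  rcases CharP.char_is_prime_or_zero K p with hpp | rfl
  · have := Fact.mk hpp
    have := charP_of_injective_algebraMap (algebraMap K Ω).injective p
    obtain ⟨e, n, hn, rfl⟩ := Nat.exists_eq_pow_mul_and_not_dvd hm.ne' p hpp.ne_one
    exact ⟨n, by rwa [Ne, CharP.cast_eq_zero_iff K p],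
      (ExpChar.pow_prime_pow_mul_eq_one_iff p e n x).mp hx⟩
  · have := CharP.charP_to_charZero K
    exact ⟨m, by exact_mod_cast hm.ne', hx⟩

theorem finiteDimensional_cyclotomicSubfield {K Ω : Type*} [Field K] [Field Ω] [Algebra K Ω]
    {m : ℕ} (hm : 0 < m) :
    FiniteDimensional K (cyclotomicSubfield K m : IntermediateField K Ω) := by
  have hfin : {x : Ω | x ^ m = 1}.Finite := by
    refine (nthRootsFinset m (1 : Ω)).finite_toSet.subset fun x hx => ?_
    simpa [mem_nthRootsFinset hm] using hx
  have := hfin.to_subtype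
  exact IntermediateField.finiteDimensional_adjoin fun x (hx : x ^ m = 1) =>
    IsIntegral.of_pow hm (hx ▸ isIntegral_one)

theorem isGalois_cyclotomicSubfield {K Ω : Type*} [Field K] [Field Ω] [Algebra K Ω]
    [IsAlgClosed Ω] {m : ℕ} (hm : 0 < m) :
    IsGalois K (cyclotomicSubfield K m : IntermediateField K Ω) := by
  have hsep : Algebra.IsSeparable K (cyclotomicSubfield K m : IntermediateField K Ω) :=
    (IntermediateField.isSeparable_adjoin_iff_isSeparable K Ω).mpr fun x hx =>
      isSeparable_of_pow_eq_one hm hx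
  have hset : {x : Ω | x ^ m = 1} = (X ^ m - 1 : K[X]).rootSet Ω := by
    ext x
    rw [mem_rootSet_of_ne (by simpa using X_pow_sub_C_ne_zero hm (1 : K))]
    simp [sub_eq_zero]
  have hnor : Normal K (cyclotomicSubfield K m : IntermediateField K Ω) := by
    have := IntermediateField.adjoin_rootSet_isSplittingField
      (IsAlgClosed.splits ((X ^ m - 1 : K[X]).map (algebraMap K Ω)))
    rw [cyclotomicSubfield, hset]
    exact Normal.of_isSplittingField (X ^ m - 1 : K[X])
  exact ⟨⟩

theorem cyclotomicSubfield_algEquiv_ext {K Ω : Type*} [Field K] [Field Ω] [Algebra K Ω] {m : ℕ}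
    {σ τ : (cyclotomicSubfield K m : IntermediateField K Ω) ≃ₐ[K]
      (cyclotomicSubfield K m : IntermediateField K Ω)}
    (h : ∀ x, x ^ m = 1 → σ x = τ x) : σ = τ := by
  have : σ.toAlgHom = τ.toAlgHom :=
    IntermediateField.algHom_ext_of_eq_adjoin _ (s := {x : Ω | x ^ m = 1}) rfl
      fun x hx => h ⟨x, mem_cyclotomicSubfield hx⟩ (Subtype.ext hx)
  ext x
  exact congrArg _ (DFunLike.congr_fun this x)

theorem cyclotomicSubfield_commute {K Ω : Type*} [Field K] [Field Ω] [Algebra K Ω] {m : ℕ}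
    (hm : 0 < m)
    (σ τ : (cyclotomicSubfield K m : IntermediateField K Ω) ≃ₐ[K]
      (cyclotomicSubfield K m : IntermediateField K Ω)) (x) : σ (τ x) = τ (σ x) := by
  suffices τ.trans σ = σ.trans τ from DFunLike.congr_fun this x
  obtain ⟨i, hi⟩ := exists_zpow_of_pow_eq_one σ.toRingEquiv hm
  obtain ⟨j, hj⟩ := exists_zpow_of_pow_eq_one τ.toRingEquiv hm
  refine cyclotomicSubfield_algEquiv_ext fun x hx => ?_
  have h1 : σ x = x ^ i := hi x hx
  have h2 : τ x = x ^ j := hj x hx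
  simp only [AlgEquiv.trans_apply, h1, h2, map_zpow₀, ← zpow_mul, mul_comm]

theorem iterate_apply_eq_mul_pow {M : Type*} [Field M] (σ : M →+* M) {x ω : M}
    (hx : σ x = x * ω) (hω : σ ω = ω) (n : ℕ) : σ^[n] x = x * ω ^ n := by
  induction n with
  | zero => simp
  | succ n ih => rw [Function.iterate_succ_apply', ih, map_mul, map_pow, hx, hω]; ring

/-- An endomorphism of prime order `p` which fixes the `q`-torsion for all primes `q ∣ m` fixes
the `m`-torsion, provided that `p ∤ m`. -/
theorem apply_eq_of_pow_eq_one_of_coprime {M : Type*} [Field M] (σ : M →+* M) {p : ℕ}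
    (hp : p.Prime) (hσ : ∀ x, σ^[p] x = x) (m : ℕ) (hm : 0 < m) (hpm : ¬ p ∣ m)
    (hfix : ∀ q : ℕ, q.Prime → q ∣ m → ∀ ω : M, ω ^ q = 1 → σ ω = ω) (x : M)
    (hx : x ^ m = 1) : σ x = x := by
  induction m using Nat.recOnMul generalizing x with
  | zero => exact absurd hm (lt_irrefl 0)
  | one => rw [pow_one] at hx; rw [hx, map_one]
  | prime q hq => exact hfix q hq dvd_rfl x hx
  | mul a b iha ihb =>
    have ha : 0 < a := Nat.pos_of_mul_pos_right hm
    have hb : 0 < b := Nat.pos_of_mul_pos_left hm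
    have hpa : ¬ p ∣ a := fun h => hpm (h.mul_right b)
    have hx0 : x ≠ 0 := IsRootOfUnityElem.ne_zero ⟨_, hm, hx⟩
    have hb1 := ihb hb (fun h => hpm (h.mul_left a)) (fun q hq h => hfix q hq (h.mul_left a))
      (x ^ a) (by rw [← pow_mul, hx])
    have ha1 := iha ha hpa (fun q hq h => hfix q hq (h.mul_right b))
    obtain ⟨ω, hω⟩ : ∃ ω, ω = σ x / x := ⟨_, rfl⟩
    have hωa : ω ^ a = 1 := by
      rw [hω, div_pow, ← map_pow, hb1, div_self (pow_ne_zero _ hx0)]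
    have hσx : σ x = x * ω := by rw [hω]; field_simp
    have hωp : ω ^ p = 1 := by
      have := iterate_apply_eq_mul_pow σ hσx (ha1 ω hωa) p
      rw [hσ] at this
      exact (mul_eq_left₀ hx0).mp this.symm
    have : ω = 1 := by
      have := pow_gcd_eq_one.mpr ⟨hωp, hωa⟩
      rwa [((Nat.Prime.coprime_iff_not_dvd hp).mpr hpa).gcd_eq_one, pow_one] at this
    rw [hσx, this, mul_one]

/-- An automorphism of prime order `p` fixes the `q`-torsion for all primes `q < p`. -/
theorem apply_eq_of_pow_prime_eq_one_of_lt {M : Type*} [Field M] (σ : M ≃+* M) {p q : ℕ}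
    (hp : p.Prime) (hq : q.Prime) (hqp : q < p) (hσ : ∀ x, σ^[p] x = x) (ω : M)
    (hω : ω ^ q = 1) : σ ω = ω := by
  obtain ⟨i, hi⟩ := exists_zpow_of_pow_eq_one σ hq.pos
  have hit : ∀ n : ℕ, σ^[n] ω = ω ^ (i ^ n) := by
    intro n
    induction n with
    | zero => simp
    | succ n ih =>
      rw [Function.iterate_succ_apply', ih, map_zpow₀, hi ω hω, ← zpow_mul, pow_succ']
  by_cases hqi : (q : ℤ) ∣ i
  · obtain ⟨c, rfl⟩ := hqi
    have h1 : σ ω = 1 := by rw [hi ω hω, zpow_mul, zpow_natCast, hω, one_zpow]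
    have : ω = 1 := σ.injective (by rw [h1, map_one])
    rw [this, map_one]
  · have h1 : Function.IsPeriodicPt σ (q - 1) ω := by
      have hf : i ^ (q - 1) ≡ 1 [ZMOD q] := by
        refine Int.ModEq.pow_card_sub_one_eq_one hq ?_
        exact (((Nat.prime_iff_prime_int.mp hq).coprime_iff_not_dvd).mpr hqi).symm
      obtain ⟨c, hc⟩ := hf.symm.dvd
      have hω0 : ω ≠ 0 := IsRootOfUnityElem.ne_zero ⟨_, hq.pos, hω⟩
      change σ^[q - 1] ω = ω
      rw [hit, show i ^ (q - 1) = q * c + 1 by omega, zpow_add_one₀ hω0, zpow_mul, zpow_natCast,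
        hω, one_zpow, one_mul]
    have h2 : Function.IsPeriodicPt σ p ω := hσ ω
    have h3 := h1.gcd h2
    have h4 : (q - 1).gcd p = 1 := by
      rw [Nat.gcd_comm]
      exact (Nat.Prime.coprime_iff_not_dvd hp).mpr fun h =>
        absurd (Nat.le_of_dvd (Nat.sub_pos_of_lt hq.one_lt) h) (by omega)
    rw [h4] at h3
    exact h3

theorem not_dvd_finrank_cyclotomicSubfield {K Ω : Type*} [Field K] [Field Ω] [Algebra K Ω]
    [IsAlgClosed Ω] {m : ℕ} (hm : 0 < m) {p : ℕ} (hp : p.Prime)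
    (h : ∀ σ : (cyclotomicSubfield K m : IntermediateField K Ω) ≃ₐ[K]
      (cyclotomicSubfield K m : IntermediateField K Ω), (∀ x, σ^[p] x = x) →
      ∀ x, x ^ m = 1 → σ x = x) :
    ¬ p ∣ Module.finrank K (cyclotomicSubfield K m : IntermediateField K Ω) := by
  intro hdvd
  have := isGalois_cyclotomicSubfield (K := K) (Ω := Ω) hm
  have := finiteDimensional_cyclotomicSubfield (K := K) (Ω := Ω) hm
  have := Fact.mk hp
  rw [← IsGalois.card_aut_eq_finrank] at hdvd
  obtain ⟨σ, hσ⟩ := exists_prime_orderOf_dvd_card' p hdvd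
  have hpow : ∀ (n : ℕ) x, σ^[n] x = (σ ^ n) x := by
    intro n x
    induction n with
    | zero => simp
    | succ n ih => rw [Function.iterate_succ_apply', ih, pow_succ', AlgEquiv.mul_apply]
  have h1 : σ = 1 := cyclotomicSubfield_algEquiv_ext fun x hx =>
    h σ (fun y => by rw [hpow, ← hσ, pow_orderOf_eq_one]; rfl) x hx
  rw [h1, orderOf_one] at hσ
  exact hp.one_lt.ne hσ

/-- If all prime factors of `m` are smaller than `p`, then `[K(μ_m) : K]` is prime to `p`. -/
theorem not_dvd_finrank_cyclotomicSubfield_of_lt {K Ω : Type*} [Field K] [Field Ω] [Algebra K Ω]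
    [IsAlgClosed Ω] {m : ℕ} (hm : 0 < m) {p : ℕ} (hp : p.Prime)
    (h : ∀ q : ℕ, q.Prime → q ∣ m → q < p) :
    ¬ p ∣ Module.finrank K (cyclotomicSubfield K m : IntermediateField K Ω) := by
  refine not_dvd_finrank_cyclotomicSubfield hm hp fun σ hσ x hx => ?_
  exact apply_eq_of_pow_eq_one_of_coprime σ.toAlgHom.toRingHom hp hσ m hm
    (fun hd => lt_irrefl _ (h p hp hd))
    (fun q hq hqm ω hω =>
      apply_eq_of_pow_prime_eq_one_of_lt σ.toRingEquiv hp hq (h q hq hqm) hσ ω hω)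
    x hx

/-- If `K` contains all `p`-power roots of unity and the `q`-th roots of unity for all primes
`q ∣ m`, then `[K(μ_m) : K]` is prime to `p`. -/
theorem not_dvd_finrank_cyclotomicSubfield_of_mem {K Ω : Type*} [Field K] [Field Ω] [Algebra K Ω]
    [IsAlgClosed Ω] {m : ℕ} (hm : 0 < m) {p : ℕ} (hp : p.Prime)
    (h : ∀ q : ℕ, q.Prime → q ∣ m → ∀ x : Ω, x ^ q = 1 → x ∈ Set.range (algebraMap K Ω))
    (h' : ∀ (i : ℕ) (x : Ω), x ^ p ^ i = 1 → x ∈ Set.range (algebraMap K Ω)) :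
    ¬ p ∣ Module.finrank K (cyclotomicSubfield K m : IntermediateField K Ω) := by
  refine not_dvd_finrank_cyclotomicSubfield hm hp fun σ hσ x hx => ?_
  have hbase : ∀ y : (cyclotomicSubfield K m : IntermediateField K Ω),
      (y : Ω) ∈ Set.range (algebraMap K Ω) → σ y = y := by
    rintro y ⟨z, hz⟩
    have : y = algebraMap K _ z := Subtype.ext hz.symm
    rw [this, AlgEquiv.commutes]
  obtain ⟨e, n, hn, hmn⟩ := Nat.exists_eq_pow_mul_and_not_dvd hm.ne' p hp.ne_one
  have hn0 : 0 < n := Nat.pos_of_ne_zero fun h0 => hn (h0 ▸ dvd_zero p)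
  have hx' : x ^ (p ^ e * n) = 1 := (congrArg (x ^ ·) hmn).symm.trans hx
  have hx0 : x ≠ 0 := IsRootOfUnityElem.ne_zero ⟨_, hm, hx⟩
  have h1 : σ (x ^ n) = x ^ n := hbase _ (h' e _ (by
    rw [mul_comm, pow_mul] at hx'
    exact congrArg Subtype.val hx'))
  have h2 : σ (x ^ p ^ e) = x ^ p ^ e :=
    apply_eq_of_pow_eq_one_of_coprime σ.toAlgHom.toRingHom hp hσ n hn0 hn
      (fun q hq hqm ω hω => hbase _ (h q hq (hmn ▸ hqm.mul_left _) _
        (congrArg Subtype.val hω))) _ (by rw [← pow_mul, hx'])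
  have h3 : (σ x / x) ^ n = 1 := by
    rw [div_pow, ← map_pow, h1, div_self (pow_ne_zero _ hx0)]
  have h4 : (σ x / x) ^ p ^ e = 1 := by
    rw [div_pow, ← map_pow, h2, div_self (pow_ne_zero _ hx0)]
  have h5 := pow_gcd_eq_one.mpr ⟨h4, h3⟩
  rw [((Nat.Prime.coprime_iff_not_dvd hp).mpr hn).pow_left e |>.gcd_eq_one, pow_one] at h5
  exact (div_eq_one_iff_eq hx0).mp h5

/-- `a` is an `n`-th power of an element of `S` up to a root of unity. -/
def IsPowModTorsion {Ω : Type*} [Field Ω] (S : Set Ω) (n : ℕ) (a : Ω) : Prop :=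
  ∃ g ∈ S, ∃ ζ : Ω, IsRootOfUnityElem ζ ∧ g ^ n = ζ * a

theorem norm_gen_pow_sub_C {K Ω : Type*} [Field K] [Field Ω] [Algebra K Ω] {p : ℕ} (hp : 0 < p)
    {a : K} (hirr : Irreducible (X ^ p - C a : K[X])) {γ : Ω} (hγ : γ ^ p = algebraMap K Ω a) :
    Module.finrank K (IntermediateField.adjoin K {γ}) = p ∧
    Algebra.norm K (IntermediateField.AdjoinSimple.gen K γ) = (-1) ^ p * -a := by
  have hint : IsIntegral K γ := IsIntegral.of_pow hp (hγ ▸ isIntegral_algebraMap)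
  have hmin : minpoly K γ = X ^ p - C a :=
    (minpoly.eq_of_irreducible_of_monic hirr (by simp [hγ]) (monic_X_pow_sub_C a hp.ne')).symm
  constructor
  · rw [IntermediateField.adjoin.finrank hint, hmin, natDegree_X_pow_sub_C]
  · have h := Algebra.PowerBasis.norm_gen_eq_coeff_zero_minpoly
      (IntermediateField.adjoin.powerBasis hint)
    rw [IntermediateField.adjoin.powerBasis_gen, IntermediateField.minpoly_gen,
      IntermediateField.adjoin.powerBasis_dim, hmin, natDegree_X_pow_sub_C] at h
    rw [h]
    simp [hp.ne]

theorem finrank_restrictScalars {F Ω : Type*} [Field F] [Field Ω] [Algebra F Ω]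
    (E : IntermediateField F Ω) (E' : IntermediateField E Ω) :
    Module.finrank F E * Module.finrank E E' = Module.finrank F (E'.restrictScalars F) :=
  Module.finrank_mul_finrank F E E'

theorem natDegree_minpoly_of_pow_eq {F Ω : Type*} [Field F] [Field Ω] [Algebra F Ω] {c γ : Ω}
    (hc : IsIntegral F c)
    (hvr : ∀ q : ℕ, 2 ≤ q → ¬ IsPowModTorsion (IntermediateField.adjoin F {c} : Set Ω) q c)
    {p : ℕ} (hp : p.Prime) (hγ : γ ^ p = c) :
    (∀ q : ℕ, 2 ≤ q → ¬ IsPowModTorsion (IntermediateField.adjoin F {γ} : Set Ω) q γ) ∧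
      (minpoly F γ).natDegree = p * (minpoly F c).natDegree := by
  have hirr : Irreducible (X ^ p - C (IntermediateField.AdjoinSimple.gen F c)) :=
    X_pow_sub_C_irreducible_of_prime hp fun b hb =>
      hvr p hp.two_le ⟨b, b.2, 1, .one, by
        have := congrArg Subtype.val hb
        simpa using this⟩
  obtain ⟨hrank, hnorm⟩ := norm_gen_pow_sub_C (Ω := Ω) hp.pos hirr (γ := γ) (by simpa using hγ)
  have hγint : IsIntegral F γ := IsIntegral.of_pow hp.pos (hγ ▸ hc)
  have hcγ : c ∈ IntermediateField.adjoin F {γ} :=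
    hγ ▸ pow_mem (IntermediateField.mem_adjoin_simple_self F γ) p
  have hres : (IntermediateField.adjoin (IntermediateField.adjoin F {c}) {γ}).restrictScalars F =
      IntermediateField.adjoin F {γ} := by
    rw [IntermediateField.adjoin_simple_adjoin_simple]
    refine le_antisymm (IntermediateField.adjoin_le_iff.mpr ?_)
      (IntermediateField.adjoin.mono _ _ _ (by simp))
    rintro x (rfl | rfl)
    · exact hcγ
    · exact IntermediateField.mem_adjoin_simple_self F _
  constructor
  · rintro q hq ⟨g, hg, ζ, hζ, hgq⟩
    have hγ0 : γ ≠ 0 := by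
      rintro rfl
      rw [zero_pow hp.ne_zero] at hγ
      exact hvr 2 le_rfl ⟨0, zero_mem _, 1, .one, by simp [← hγ]⟩
    rw [← hres] at hg
    let g' : IntermediateField.adjoin (IntermediateField.adjoin F {c}) {γ} := ⟨g, hg⟩
    let γ' := IntermediateField.AdjoinSimple.gen (IntermediateField.adjoin F {c}) γ
    have hγ0' : γ' ≠ 0 := fun h => hγ0 (congrArg Subtype.val h)
    have hζ' : IsRootOfUnityElem (g' ^ q / γ') := by
      refine IsRootOfUnityElem.of_map
        (f := algebraMap (IntermediateField.adjoin (IntermediateField.adjoin F {c}) {γ}) Ω)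
        Subtype.val_injective ?_
      have : algebraMap (IntermediateField.adjoin (IntermediateField.adjoin F {c}) {γ}) Ω
          (g' ^ q / γ') = g ^ q / γ := rfl
      rw [this, hgq, mul_div_cancel_right₀ _ hγ0]
      exact hζ
    have hN : Algebra.norm (IntermediateField.adjoin F {c}) g' ^ q =
        Algebra.norm (IntermediateField.adjoin F {c}) (g' ^ q / γ') *
          ((-1) ^ p * -IntermediateField.AdjoinSimple.gen F c) := by
      rw [← hnorm, ← map_mul, div_mul_cancel₀ _ hγ0', map_pow]
    refine hvr q hq ⟨_, (Algebra.norm (IntermediateField.adjoin F {c}) g').2,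
      algebraMap (IntermediateField.adjoin F {c}) Ω
        (Algebra.norm (IntermediateField.adjoin F {c}) (g' ^ q / γ') * (-1) ^ p * -1), ?_, ?_⟩
    · exact IsRootOfUnityElem.map _
        (((hζ'.map _).mul (IsRootOfUnityElem.neg_one.pow p)).mul IsRootOfUnityElem.neg_one)
    · have := congrArg (algebraMap (IntermediateField.adjoin F {c}) Ω) hN
      simp only [map_mul, map_pow, map_neg, map_one,
        IntermediateField.AdjoinSimple.algebraMap_gen] at this ⊢
      rw [show ∀ x : IntermediateField.adjoin F {c}, (x : Ω) = algebraMap _ Ω x from fun _ => rfl,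
        this]
      ring
  · rw [← IntermediateField.adjoin.finrank hγint, ← IntermediateField.adjoin.finrank hc, ← hres,
      mul_comm, ← hrank]
    exact (finrank_restrictScalars _ _).symm

/-- If `c` is not a proper power modulo torsion in `F(c)`, then its minimal polynomial over `F` is
hereditarily irreducible. -/
theorem heredIrreducible_minpoly {F Ω : Type*} [Field F] [Field Ω] [Algebra F Ω] [IsAlgClosed Ω]
    {c : Ω} (hc : IsIntegral F c)
    (hvr : ∀ q : ℕ, 2 ≤ q → ¬ IsPowModTorsion (IntermediateField.adjoin F {c} : Set Ω) q c) :
    HeredIrreducible (minpoly F c) := by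
  intro m hm
  obtain ⟨γ, hγ⟩ := IsAlgClosed.exists_pow_nat_eq c hm
  have key : ∀ m : ℕ, 0 < m → ∀ c γ : Ω, IsIntegral F c → γ ^ m = c →
      (∀ q : ℕ, 2 ≤ q → ¬ IsPowModTorsion (IntermediateField.adjoin F {c} : Set Ω) q c) →
      (∀ q : ℕ, 2 ≤ q → ¬ IsPowModTorsion (IntermediateField.adjoin F {γ} : Set Ω) q γ) ∧
      (minpoly F γ).natDegree = m * (minpoly F c).natDegree := by
    intro m
    induction m using Nat.recOnMul with
    | zero => simp
    | one => rintro - c γ - rfl h; simpa using h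
    | prime p hp => intro _ c γ hc hγ h; exact natDegree_minpoly_of_pow_eq hc h hp hγ
    | mul a b iha ihb =>
      intro hab c γ hc hγ h
      have ha : 0 < a := Nat.pos_of_mul_pos_right hab
      have hb : 0 < b := Nat.pos_of_mul_pos_left hab
      rw [mul_comm, pow_mul] at hγ
      obtain ⟨h1, h2⟩ := iha ha c (γ ^ b) hc hγ h
      obtain ⟨h3, h4⟩ := ihb hb (γ ^ b) γ (IsIntegral.of_pow ha (hγ ▸ hc)) rfl h1
      exact ⟨h3, by rw [h4, h2]; ring⟩
  have hdeg := (key m hm c γ hc hγ hvr).2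
  have hγint : IsIntegral F γ := IsIntegral.of_pow hm (hγ ▸ hc)
  have heq : minpoly F γ = (minpoly F c).comp (X ^ m) := by
    refine (eq_of_monic_of_dvd_of_natDegree_le (minpoly.monic hγint)
      ((minpoly.monic hc).comp (monic_X_pow m) (by simpa using hm.ne')) (minpoly.dvd F γ ?_) ?_).symm
    · simp [aeval_comp, hγ]
    · rw [natDegree_comp, natDegree_X_pow, hdeg, mul_comm]
  rw [← heq]
  exact minpoly.irreducible hγint

theorem HeredIrreducible.of_associated {F : Type*} [Field F] {P Q : F[X]} (h : Associated P Q)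
    (hP : HeredIrreducible P) : HeredIrreducible Q := by
  obtain ⟨u, rfl⟩ := h
  obtain ⟨r, hr, hu⟩ := Polynomial.isUnit_iff.mp u.isUnit
  intro n hn
  rw [← hu, mul_comp, C_comp]
  exact (irreducible_mul_isUnit (isUnit_C.mpr hr)).mpr (hP n hn)

theorem IsPowModTorsion.mono {Ω : Type*} [Field Ω] {S T : Set Ω} (h : S ⊆ T) {n : ℕ} {a : Ω}
    (ha : IsPowModTorsion S n a) : IsPowModTorsion T n a := by
  obtain ⟨g, hg, ha⟩ := ha
  exact ⟨g, h hg, ha⟩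

theorem IsPowModTorsion.of_dvd {K Ω : Type*} [Field K] [Field Ω] [Algebra K Ω]
    {E : IntermediateField K Ω} {n d : ℕ} {a : Ω} (ha : IsPowModTorsion (E : Set Ω) n a)
    (h : d ∣ n) : IsPowModTorsion (E : Set Ω) d a := by
  obtain ⟨g, hg, ζ, hζ, hgn⟩ := ha
  obtain ⟨e, rfl⟩ := h
  exact ⟨g ^ e, pow_mem hg e, ζ, hζ, by rw [← pow_mul, mul_comm, hgn]⟩

theorem isPowModTorsion_one {K Ω : Type*} [Field K] [Field Ω] [Algebra K Ω]
    (E : IntermediateField K Ω) (a : K) :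
    IsPowModTorsion (E : Set Ω) 1 (algebraMap K Ω a) :=
  ⟨_, E.algebraMap_mem a, 1, .one, by simp⟩

theorem IsPowModTorsion.exists_intermediateField {K Ω : Type*} [Field K] [Field Ω] [Algebra K Ω]
    {E : IntermediateField K Ω} {n : ℕ} {a : K} (ha : a ≠ 0)
    (h : IsPowModTorsion (E : Set Ω) n (algebraMap K Ω a)) :
    ∃ g ζ : E, IsRootOfUnityElem ζ ∧ g ^ n = ζ * algebraMap K E a := by
  obtain ⟨g, hg, ζ, hζ, hgn⟩ := h
  have ha' : algebraMap K Ω a ≠ 0 := by simpa using ha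
  have hζE : ζ ∈ E := by
    rw [eq_div_of_mul_eq ha' hgn.symm]
    exact div_mem (pow_mem hg n) (E.algebraMap_mem a)
  exact ⟨⟨g, hg⟩, ⟨ζ, hζE⟩, IsRootOfUnityElem.of_map (f := algebraMap E Ω)
    Subtype.val_injective hζ, Subtype.ext hgn⟩

theorem IsPowModTorsion.descend {K Ω : Type*} [Field K] [Field Ω] [Algebra K Ω]
    {E : IntermediateField K Ω} [FiniteDimensional K E] {n : ℕ} (hn : 0 < n) {a : K} (ha : a ≠ 0)
    (h : IsPowModTorsion (E : Set Ω) n (algebraMap K Ω a)) :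
    IsPowModTorsion ((⊥ : IntermediateField K Ω) : Set Ω) (n / n.gcd (Module.finrank K E))
      (algebraMap K Ω a) := by
  obtain ⟨g, ξ, hξ, hg⟩ := h.exists_intermediateField ha
  obtain ⟨k, ζ, hζ, hk⟩ := exists_pow_eq_mul_of_finiteDimensional ha hn hξ hg
  exact ⟨_, IntermediateField.algebraMap_mem _ k, _, hζ.map (algebraMap K Ω), by
    rw [← map_pow, hk, map_mul]⟩

theorem IsPowModTorsion.descend_prime_pow {K Ω : Type*} [Field K] [Field Ω] [Algebra K Ω]
    {E : IntermediateField K Ω} [FiniteDimensional K E] {p j : ℕ} (hp : p.Prime)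
    (hpE : ¬ p ∣ Module.finrank K E) {a : K} (ha : a ≠ 0)
    (h : IsPowModTorsion (E : Set Ω) (p ^ j) (algebraMap K Ω a)) :
    IsPowModTorsion ((⊥ : IntermediateField K Ω) : Set Ω) (p ^ j) (algebraMap K Ω a) := by
  have := h.descend (pow_pos hp.pos j) ha
  rwa [(((Nat.Prime.coprime_iff_not_dvd hp).mpr hpE).pow_left j).gcd_eq_one, Nat.div_one] at this

theorem IsPowModTorsion.mem_bot_of_cyclotomicSubfield {K Ω : Type*} [Field K] [Field Ω]
    [Algebra K Ω] [IsAlgClosed Ω] {m : ℕ} (hm : 0 < m) {p e i : ℕ} (hp : p.Prime) {a : K}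
    (ha : a ≠ 0) (he : IsPowModTorsion ((⊥ : IntermediateField K Ω) : Set Ω) (p ^ e)
      (algebraMap K Ω a))
    (he' : ¬ IsPowModTorsion ((⊥ : IntermediateField K Ω) : Set Ω) (p ^ (e + 1))
      (algebraMap K Ω a))
    (h : IsPowModTorsion ((cyclotomicSubfield K m : IntermediateField K Ω) : Set Ω) (p ^ (e + i))
      (algebraMap K Ω a)) (him : p ^ i ∣ m) {x : Ω} (hx : x ^ p ^ i = 1) :
    x ∈ Set.range (algebraMap K Ω) := by
  have := isGalois_cyclotomicSubfield (K := K) (Ω := Ω) hm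
  set M : IntermediateField K Ω := cyclotomicSubfield K m
  obtain ⟨g₁, hg₁, ζ, hζ, hg⟩ := he
  obtain ⟨g, rfl⟩ := IntermediateField.mem_bot.mp hg₁
  obtain ⟨h, ξ, hξ, hh⟩ := h.exists_intermediateField ha
  have ha' : algebraMap K Ω a ≠ 0 := by simpa using ha
  have hpe := pow_pos hp.pos e
  have hg0 : g ≠ 0 := by
    rintro rfl
    rw [map_zero, zero_pow hpe.ne'] at hg
    exact mul_ne_zero hζ.ne_zero ha' hg.symm
  have hgv : ∀ k ζ : K, IsRootOfUnityElem ζ → k ^ p ≠ ζ * g := by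
    intro k ζ' hζ' hk
    refine he' ⟨_, IntermediateField.algebraMap_mem _ k, algebraMap K Ω ζ' ^ p ^ e * ζ,
      ((hζ'.map _).pow _).mul hζ, ?_⟩
    rw [pow_succ', pow_mul, ← map_pow, hk, map_mul, mul_pow, hg, mul_assoc]
  have hgM : algebraMap K M g ≠ 0 := by simpa using hg0
  have hroot : IsRootOfUnityElem (h ^ p ^ i / algebraMap K M g) := by
    refine IsRootOfUnityElem.of_pow hpe ?_
    have hg' : IsRootOfUnityElem (algebraMap K M g ^ p ^ e / algebraMap K M a) := by
      refine IsRootOfUnityElem.of_map (f := algebraMap M Ω) Subtype.val_injective ?_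
      rw [map_div₀, map_pow, ← IsScalarTower.algebraMap_apply, ← IsScalarTower.algebraMap_apply,
        hg, mul_div_cancel_right₀ _ ha']
      exact hζ
    have heq : (h ^ p ^ i / algebraMap K M g) ^ p ^ e =
        ξ * (algebraMap K M g ^ p ^ e / algebraMap K M a)⁻¹ := by
      rw [div_pow, ← pow_mul, ← pow_add, add_comm i, hh]
      field_simp
    rw [heq]
    exact hξ.mul hg'.inv
  obtain ⟨c, hc⟩ := him
  have hxM : x ∈ M := mem_cyclotomicSubfield (by rw [hc, pow_mul, hx, one_pow])
  obtain ⟨y, hy⟩ := IntermediateField.mem_bot.mp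
    (mem_bot_of_pow_eq_mul_of_commute (cyclotomicSubfield_commute hm) hp hg0 hgv hroot
      (div_mul_cancel₀ _ hgM).symm (x := (⟨x, hxM⟩ : M)) (Subtype.ext hx))
  exact ⟨y, congrArg Subtype.val hy⟩

theorem exists_bound_of_range {K Ω : Type*} [Field K] [Field Ω] [Algebra K Ω] [IsAlgClosed Ω]
    {a : K} (ha : a ≠ 0) {B D : ℕ} (hB : ∀ n : ℕ, IsPowModTorsion
      ((⊥ : IntermediateField K Ω) : Set Ω) n (algebraMap K Ω a) → n ≤ B) (hD : 0 < D)
    (hDK : ∀ x : Ω, x ^ D = 1 → x ∈ Set.range (algebraMap K Ω)) {p : ℕ} (hp : p.Prime)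
    (hpD : p ∣ D) :
    ∃ J : ℕ, ∀ k j : ℕ, IsPowModTorsion
      ((cyclotomicSubfield K (D ^ k) : IntermediateField K Ω) : Set Ω) (p ^ j)
        (algebraMap K Ω a) → j ≤ J := by
  have hle : ∀ j, IsPowModTorsion ((⊥ : IntermediateField K Ω) : Set Ω) (p ^ j)
      (algebraMap K Ω a) → j ≤ B := fun j hj =>
    (Nat.lt_pow_self hp.one_lt).le.trans (hB _ hj)
  by_cases htor : ∀ (i : ℕ) (x : Ω), x ^ p ^ i = 1 → x ∈ Set.range (algebraMap K Ω)
  · refine ⟨B, fun k j h => hle j ?_⟩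
    have := finiteDimensional_cyclotomicSubfield (K := K) (Ω := Ω) (pow_pos hD k)
    refine h.descend_prime_pow hp
      (not_dvd_finrank_cyclotomicSubfield_of_mem (pow_pos hD k) hp ?_ htor) ha
    intro q hq hqD x hx
    obtain ⟨c, rfl⟩ := hq.dvd_of_dvd_pow hqD
    exact hDK x (by rw [pow_mul, hx, one_pow])
  · push Not at htor
    obtain ⟨i, x, hx, hxK⟩ := htor
    classical
    have hex : ∃ e, ¬ IsPowModTorsion ((⊥ : IntermediateField K Ω) : Set Ω) (p ^ (e + 1))
      (algebraMap K Ω a) := ⟨B, fun h => absurd (hle _ h) (by omega)⟩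
    obtain ⟨e, he', hmin⟩ : ∃ e, ¬ IsPowModTorsion ((⊥ : IntermediateField K Ω) : Set Ω)
        (p ^ (e + 1)) (algebraMap K Ω a) ∧ ∀ e' < e, IsPowModTorsion
        ((⊥ : IntermediateField K Ω) : Set Ω) (p ^ (e' + 1)) (algebraMap K Ω a) :=
      ⟨Nat.find hex, Nat.find_spec hex, fun e' h => not_not.mp (Nat.find_min hex h)⟩
    have he : IsPowModTorsion ((⊥ : IntermediateField K Ω) : Set Ω) (p ^ e)
        (algebraMap K Ω a) := by
      cases e with
      | zero => simpa using isPowModTorsion_one ⊥ a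
      | succ e => exact hmin e (Nat.lt_succ_self e)
    refine ⟨e + i, fun k j h => ?_⟩
    by_contra! hlt
    refine hxK (IsPowModTorsion.mem_bot_of_cyclotomicSubfield (m := D ^ (k + i))
      (pow_pos hD _) hp ha he he' ((h.of_dvd (pow_dvd_pow p hlt.le)).mono
        (cyclotomicSubfield_mono (pow_dvd_pow D (Nat.le_add_right k i)))) ?_ hx)
    exact (pow_dvd_pow_of_dvd hpD i).trans (pow_dvd_pow D (Nat.le_add_left i k))

theorem exists_bound_cyclotomicSubfield {K Ω : Type*} [Field K] [Field Ω] [Algebra K Ω]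
    [IsAlgClosed Ω] {a : K} (ha : a ≠ 0) {B D : ℕ} (hB : ∀ n : ℕ, IsPowModTorsion
      ((⊥ : IntermediateField K Ω) : Set Ω) n (algebraMap K Ω a) → n ≤ B) (hD : 0 < D)
    {p : ℕ} (hp : p.Prime) (hpD : p ∣ D) :
    ∃ J : ℕ, ∀ k j : ℕ, IsPowModTorsion
      ((cyclotomicSubfield K (D ^ k) : IntermediateField K Ω) : Set Ω) (p ^ j)
        (algebraMap K Ω a) → j ≤ J := by
  set L : IntermediateField K Ω := cyclotomicSubfield K D
  have hfd : FiniteDimensional K L := finiteDimensional_cyclotomicSubfield hD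
  have haL : algebraMap K L a ≠ 0 := by simpa using ha
  have hmap : algebraMap L Ω (algebraMap K L a) = algebraMap K Ω a := rfl
  have hBL : ∀ n : ℕ, IsPowModTorsion ((⊥ : IntermediateField L Ω) : Set Ω) n
      (algebraMap L Ω (algebraMap K L a)) → n ≤ B * Module.finrank K L := by
    intro n hn
    rcases Nat.eq_zero_or_pos n with rfl | hn0
    · exact Nat.zero_le _
    have h1 : IsPowModTorsion (L : Set Ω) n (algebraMap K Ω a) := by
      refine hn.mono fun x hx => ?_
      obtain ⟨y, rfl⟩ := IntermediateField.mem_bot.mp hx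
      exact y.2
    have h2 := hB _ (h1.descend hn0 ha)
    calc n = n / n.gcd (Module.finrank K L) * n.gcd (Module.finrank K L) :=
          (Nat.div_mul_cancel (Nat.gcd_dvd_left _ _)).symm
      _ ≤ B * Module.finrank K L :=
          Nat.mul_le_mul h2 (Nat.le_of_dvd Module.finrank_pos (Nat.gcd_dvd_right _ _))
  obtain ⟨J, hJ⟩ := exists_bound_of_range haL hBL hD
    (fun x hx => ⟨⟨x, mem_cyclotomicSubfield hx⟩, rfl⟩) hp hpD
  refine ⟨J, fun k j h => hJ k j ?_⟩
  rw [hmap]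
  refine h.mono ?_
  have : cyclotomicSubfield K (D ^ k) ≤
      (cyclotomicSubfield L (D ^ k) : IntermediateField L Ω).restrictScalars K :=
    IntermediateField.adjoin_le_iff.mpr fun x hx => mem_cyclotomicSubfield (K := L) hx
  exact this

theorem exists_mem_cyclotomicSubfield_of_pow_mem {K Ω : Type*} [Field K] [Field Ω] [Algebra K Ω]
    {D N : ℕ} (hN : 0 < N) (hND : ∀ q : ℕ, q.Prime → q ∣ N → q ∣ D) {η : Ω}
    (hη : IsRootOfUnityElem η) {k : ℕ}
    (h : η ^ N ∈ (cyclotomicSubfield K (D ^ k) : IntermediateField K Ω)) :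
    ∃ k', η ∈ (cyclotomicSubfield K (D ^ k') : IntermediateField K Ω) := by
  induction N using Nat.recOnMul generalizing k η with
  | zero => exact absurd hN (lt_irrefl 0)
  | one => exact ⟨k, by simpa using h⟩
  | prime q hq =>
    obtain ⟨w, hw, hηw⟩ := hη
    obtain ⟨r, v, hv, rfl⟩ := Nat.exists_eq_pow_mul_and_not_dvd hw.ne' q hq.ne_one
    have hη0 : η ≠ 0 := IsRootOfUnityElem.ne_zero ⟨_, hw, hηw⟩
    have hle : ∀ m ≤ k + (r + 1), (cyclotomicSubfield K (D ^ m) : IntermediateField K Ω) ≤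
        cyclotomicSubfield K (D ^ (k + (r + 1))) := fun m hm =>
      cyclotomicSubfield_mono (pow_dvd_pow D hm)
    have h1 : η ^ q ^ (r + 1) ∈ (cyclotomicSubfield K (D ^ (k + (r + 1))) :
        IntermediateField K Ω) := by
      rw [pow_succ', pow_mul]
      exact pow_mem (hle k (by omega) h) _
    have h2 : η ^ v ∈ (cyclotomicSubfield K (D ^ (k + (r + 1))) : IntermediateField K Ω) := by
      refine hle (r + 1) (by omega) (mem_cyclotomicSubfield ?_)
      obtain ⟨c, hc⟩ := pow_dvd_pow_of_dvd (hND q hq dvd_rfl) (r + 1)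
      rw [hc, ← pow_mul, show v * (q ^ (r + 1) * c) = q ^ r * v * (q * c) by ring, pow_mul η, hηw,
        one_pow]
    have hbez := Nat.gcd_eq_gcd_ab (q ^ (r + 1)) v
    rw [(((Nat.Prime.coprime_iff_not_dvd hq).mpr hv).pow_left (r + 1)).gcd_eq_one] at hbez
    refine ⟨k + (r + 1), ?_⟩
    have hmem := mul_mem (zpow_mem h1 (Nat.gcdA (q ^ (r + 1)) v))
      (zpow_mem h2 (Nat.gcdB (q ^ (r + 1)) v))
    rwa [← zpow_natCast, ← zpow_natCast, ← zpow_mul, ← zpow_mul, ← zpow_add₀ hη0, ← hbez,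
      Nat.cast_one, zpow_one] at hmem
  | mul a b iha ihb =>
    rw [pow_mul] at h
    obtain ⟨k₁, h₁⟩ := ihb (Nat.pos_of_mul_pos_left hN) (fun q hq hqb => hND q hq (hqb.mul_left a))
      (hη.pow a) h
    exact iha (Nat.pos_of_mul_pos_right hN) (fun q hq hqa => hND q hq (hqa.mul_right b)) hη h₁

/-- If `a` is rootless modulo torsion in `K`, there is an `N` such that no `N`-th root `c` of `a`
is a proper power modulo torsion in `K(c)`. -/
theorem exists_pow_forall_not_isPowModTorsion {K Ω : Type*} [Field K] [Field Ω] [Algebra K Ω]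
    [IsAlgClosed Ω] {a : K} (ha : a ≠ 0) {B : ℕ} (hB : ∀ n : ℕ, IsPowModTorsion
      ((⊥ : IntermediateField K Ω) : Set Ω) n (algebraMap K Ω a) → n ≤ B) :
    ∃ N : ℕ, 0 < N ∧ ∀ c : Ω, c ^ N = algebraMap K Ω a →
      ∃ E : IntermediateField K Ω, c ∈ E ∧
        ∀ q : ℕ, 2 ≤ q → ¬ IsPowModTorsion (E : Set Ω) q c := by
  set D := B.factorial
  have hD : 0 < D := B.factorial_pos
  have ha' : algebraMap K Ω a ≠ 0 := by simpa using ha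
  let R : ℕ → Prop := fun n => ∃ k : ℕ, IsPowModTorsion
    ((cyclotomicSubfield K (D ^ k) : IntermediateField K Ω) : Set Ω) n (algebraMap K Ω a)
  have hR_dvd : ∀ {n d}, R n → d ∣ n → R d := fun ⟨k, hk⟩ hd => ⟨k, hk.of_dvd hd⟩
  have hR_prime : ∀ p : ℕ, p.Prime → R p → p ≤ B := by
    rintro p hp ⟨k, hk⟩
    by_contra! hlt
    have := finiteDimensional_cyclotomicSubfield (K := K) (Ω := Ω) (pow_pos hD k)
    rw [← pow_one p] at hk
    refine absurd (hB _ (hk.descend_prime_pow hp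
      (not_dvd_finrank_cyclotomicSubfield_of_lt (pow_pos hD k) hp fun q hq hqD => ?_) ha))
      (by simpa using hlt)
    exact lt_of_le_of_lt ((Nat.Prime.dvd_factorial hq).mp (hq.dvd_of_dvd_pow hqD)) hlt
  have hJ : ∀ p : ℕ, ∃ J : ℕ, p.Prime → p ≤ B → ∀ j, R (p ^ j) → j ≤ J := by
    intro p
    by_cases hp : p.Prime ∧ p ≤ B
    · obtain ⟨J, hJ⟩ := exists_bound_cyclotomicSubfield (Ω := Ω) ha hB hD hp.1
        ((Nat.Prime.dvd_factorial hp.1).mpr hp.2)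
      exact ⟨J, fun _ _ j ⟨k, hk⟩ => hJ k j hk⟩
    · exact ⟨0, fun h1 h2 => absurd ⟨h1, h2⟩ hp⟩
  choose J hJ using hJ
  obtain ⟨Z, hZ⟩ : ∃ Z : ℕ, ∀ n, R n → n ≤ Z := by
    refine ⟨∏ p ∈ (Finset.range (B + 1)).filter Nat.Prime, p ^ J p, fun n hn => ?_⟩
    refine Nat.le_of_dvd (Finset.prod_pos fun p hp =>
      pow_pos (Finset.mem_filter.mp hp).2.pos _) ?_
    rw [Nat.dvd_iff_prime_pow_dvd_dvd]
    intro p j hp hpj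
    rcases Nat.eq_zero_or_pos j with rfl | hj
    · simp
    have hpB := hR_prime p hp (hR_dvd hn ((dvd_pow_self p hj.ne').trans hpj))
    refine (pow_dvd_pow p (hJ p hp hpB j (hR_dvd hn hpj))).trans
      (Finset.dvd_prod_of_mem (fun p => p ^ J p) ?_)
    simpa [Nat.lt_succ_iff] using ⟨hpB, hp⟩
  obtain ⟨N, hN, hmax⟩ : ∃ N, R N ∧ ∀ n, R n → n ≤ N := by
    classical
    have h1 : R 1 := ⟨0, isPowModTorsion_one _ a⟩
    exact ⟨Nat.findGreatest R Z, Nat.findGreatest_spec (hZ 1 h1) h1,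
      fun n hn => Nat.le_findGreatest (hZ n hn) hn⟩
  have hN0 : 0 < N := hmax 1 ⟨0, isPowModTorsion_one _ a⟩
  refine ⟨N, hN0, fun c hc => ?_⟩
  obtain ⟨k, h, hh, ξ, hξ, hhN⟩ := id hN
  have hh0 : h ≠ 0 := by
    rintro rfl
    rw [zero_pow hN0.ne'] at hhN
    exact mul_ne_zero hξ.ne_zero ha' hhN.symm
  have hcN : (c / h) ^ N = ξ⁻¹ := by
    rw [div_pow, hc, hhN]
    have := hξ.ne_zero
    field_simp
  have hξM : ξ ∈ (cyclotomicSubfield K (D ^ k) : IntermediateField K Ω) := by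
    rw [eq_div_of_mul_eq ha' hhN.symm]
    exact div_mem (pow_mem hh N) (IntermediateField.algebraMap_mem _ a)
  obtain ⟨k', hk'⟩ := exists_mem_cyclotomicSubfield_of_pow_mem (D := D) hN0
    (fun q hq hqN => (Nat.Prime.dvd_factorial hq).mpr (hR_prime q hq (hR_dvd hN hqN)))
    (IsRootOfUnityElem.of_pow hN0 (hcN ▸ hξ.inv)) (hcN ▸ inv_mem hξM)
  refine ⟨cyclotomicSubfield K (D ^ (k + k')), ?_, ?_⟩
  · rw [← div_mul_cancel₀ c hh0]
    exact mul_mem (cyclotomicSubfield_mono (pow_dvd_pow D (Nat.le_add_left _ _)) hk')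
      (cyclotomicSubfield_mono (pow_dvd_pow D (Nat.le_add_right _ _)) hh)
  · rintro q hq ⟨g, hg, ζ, hζ, hgq⟩
    have := hmax (q * N) ⟨k + k', g, hg, ζ ^ N, hζ.pow N, by rw [pow_mul, hgq, mul_pow, hc]⟩
    nlinarith

open IntermediateField in
/-- If every root `a` of the separable irreducible `P` (none of which is zero or a root of
unity) is rootless modtor in `F(a)`, then `P` has good heredity over `F`. -/
theorem stmt6 {F : Type*} [Field F] (P : F[X]) (hsep : P.Separable) (hirr : Irreducible P)
    (hroots : ∀ b : AlgebraicClosure F, Polynomial.aeval b P = 0 →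
      b ≠ 0 ∧ ¬ IsRootOfUnityElem b)
    (hrm : ∀ b : AlgebraicClosure F, Polynomial.aeval b P = 0 →
      RootlessModtorElem (IntermediateField.AdjoinSimple.gen F b)) :
    HasGoodHeredity P := by
  obtain ⟨a, ha⟩ := IsAlgClosed.exists_aeval_eq_zero (AlgebraicClosure F) P
    (degree_pos_of_irreducible hirr).ne'
  obtain ⟨ha0, -⟩ := hroots a ha
  have hg0 : AdjoinSimple.gen F a ≠ 0 := fun h => ha0 (congrArg Subtype.val h)
  obtain ⟨B, hB⟩ := (hrm a ha).bddAbove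
  have hbound : ∀ n : ℕ, IsPowModTorsion
      ((⊥ : IntermediateField F⟮a⟯ (AlgebraicClosure F)) : Set (AlgebraicClosure F)) n
      (algebraMap F⟮a⟯ (AlgebraicClosure F) (AdjoinSimple.gen F a)) → n ≤ B := by
    intro n hn
    rcases Nat.eq_zero_or_pos n with rfl | hn0
    · exact Nat.zero_le _
    obtain ⟨g, ζ, hζ, hg⟩ := hn.exists_intermediateField hg0
    obtain ⟨e, -⟩ : ∃ e : (⊥ : IntermediateField F⟮a⟯ (AlgebraicClosure F)) ≃ₐ[F⟮a⟯] F⟮a⟯, True :=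
      ⟨botEquiv _ _, trivial⟩
    exact hB ⟨hn0, e ζ, e g, hζ.map e, by
      rw [← map_pow, hg, map_mul, AlgEquiv.commutes]; rfl⟩
  obtain ⟨N, hN0, hN⟩ := exists_pow_forall_not_isPowModTorsion hg0 hbound
  have hcomp : ∀ x : AlgebraicClosure F, aeval x (P.comp (X ^ N)) = aeval (x ^ N) P := fun x => by
    simp [aeval_comp]
  have hdeg : 0 < (P.comp (X ^ N)).natDegree := by
    rw [natDegree_comp, natDegree_X_pow]
    exact Nat.mul_pos hirr.natDegree_pos hN0
  obtain ⟨l, hl, hprod, -⟩ := (WfDvdMonoid.not_isUnit_iff_exists_factors_eq (P.comp (X ^ N))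
    (ne_zero_of_natDegree_gt hdeg)).mp fun hu => hdeg.ne' (natDegree_eq_zero_of_isUnit hu)
  refine ⟨N, hN0, l, fun Q hQ => ?_, hprod.symm⟩
  have hQirr := hl Q hQ
  obtain ⟨b, hb⟩ := IsAlgClosed.exists_aeval_eq_zero (AlgebraicClosure F) Q
    (degree_pos_of_irreducible hQirr).ne'
  have hbP : aeval (b ^ N) P = 0 := by
    rw [← hcomp]
    exact aeval_eq_zero_of_dvd_aeval_eq_zero (hprod ▸ Multiset.dvd_prod hQ) hb
  obtain ⟨σ, hσ⟩ := (isConjRoot_iff_exists_algEquiv (K := F) (x := a) (y := b ^ N)).mp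
    ((minpoly.eq_of_irreducible hirr ha).symm.trans (minpoly.eq_of_irreducible hirr hbP))
  have hcN : σ b ^ N = a := by rw [← map_pow, hσ]
  have hcQ : aeval (σ b) Q = 0 := by rw [aeval_algHom_apply, hb, map_zero]
  obtain ⟨E, hcE, hE⟩ := hN (σ b) hcN
  have hcint : IsIntegral F (σ b) := Algebra.IsIntegral.isIntegral _
  refine HeredIrreducible.of_associated ?_ (heredIrreducible_minpoly hcint fun q hq h =>
    hE q hq (h.mono ?_))
  · exact ((minpoly.irreducible hcint).dvd_irreducible_iff_associated hQirr).mp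
      (minpoly.dvd F _ hcQ)
  · have : F⟮σ b⟯ ≤ E.restrictScalars F := adjoin_simple_le_iff.mpr hcE
    exact this
end

section
/- There exists a field F that is rootless modtor but whose multiplicative group is not free modtor, i.e., the quotient F^×/μ(F) of the multiplicative group of F by its torsion subgroup is not a free abelian group. -/
open Polynomial

theorem algebraicIndependent_pair_iff_transcendental {A : Type*} [CommRing A] (x y : A) :
    AlgebraicIndependent ℤ ![x, y] ↔
      Transcendental ℤ y ∧ Transcendental (Algebra.adjoin ℤ {y}) x := by
  rw [AlgebraicIndependent.iff_transcendental_adjoin_image (0 : Fin 2)]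
  have hset : ![x, y] '' {0}ᶜ = {y} := by
    ext z
    simp [Fin.exists_fin_two, eq_comm]
  let _ : Unique {j : Fin 2 // j ≠ 0} :=
    ⟨⟨⟨1, by decide⟩⟩, fun ⟨j, hj⟩ => Subtype.ext (by change j = 1; omega)⟩
  rw [hset, algebraicIndependent_unique_type_iff]
  rfl

theorem AlgebraicIndependent.pair_symm {A : Type*} [CommRing A] {x y : A}
    (h : AlgebraicIndependent ℤ ![x, y]) : AlgebraicIndependent ℤ ![y, x] := by
  convert h.comp (Equiv.swap (0 : Fin 2) 1) (Equiv.injective _) using 1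
  ext i
  fin_cases i <;> simp

theorem exists_pos_transcendental (R : Type*) [CommRing R] [IsDomain R] [Algebra R ℝ] [Countable R]
    [Module.IsTorsionFree R ℝ] : ∃ x : ℝ, 0 < x ∧ Transcendental R x := by
  by_contra! h
  have hsub : Set.Ioi (0 : ℝ) ⊆ {x | IsAlgebraic R x} := fun x hx => not_not.1 (h x hx)
  have hc := ((Algebraic.countable R ℝ).mono hsub).le_aleph0
  rw [Cardinal.mk_Ioi_real] at hc
  exact hc.not_gt Cardinal.aleph0_lt_continuum

theorem exists_pos_algebraicIndependent_pair :
    ∃ x y : ℝ, 0 < x ∧ 0 < y ∧ AlgebraicIndependent ℤ ![x, y] := by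
  obtain ⟨y, hy0, hy⟩ := exists_pos_transcendental ℤ
  have : Countable (Algebra.adjoin ℤ {y}) := by
    have : Countable ℤ[X] := by
      rw [← Cardinal.mk_le_aleph0_iff]
      exact Polynomial.cardinalMk_le_max.trans (by simp)
    rw [Algebra.adjoin_singleton_eq_range_aeval]
    exact (AlgHom.rangeRestrict_surjective (aeval (R := ℤ) y)).countable
  obtain ⟨x, hx0, hx⟩ := exists_pos_transcendental (Algebra.adjoin ℤ {y})
  exact ⟨x, y, hx0, hy0, (algebraicIndependent_pair_iff_transcendental x y).2 ⟨hy, hx⟩⟩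

theorem AlgebraicIndependent.pair_sqrt_div {K : Type*} [Field K] {x y z : K}
    (h : AlgebraicIndependent ℤ ![x, y]) (hx : x ≠ 0) (hy : y ≠ 0) (hz : z ^ 2 = y / x) :
    AlgebraicIndependent ℤ ![y, z] := by
  rw [algebraicIndependent_pair_iff_transcendental] at h
  refine AlgebraicIndependent.pair_symm ((algebraicIndependent_pair_iff_transcendental z y).2
    ⟨h.1, fun hza => h.2 ?_⟩)
  have hx' : x = y * (z ^ 2)⁻¹ := by rw [hz]; field_simp
  rw [hx']
  have hya : IsAlgebraic (Algebra.adjoin ℤ {y}) y :=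
    isAlgebraic_algebraMap (⟨y, Algebra.self_mem_adjoin_singleton ℤ y⟩ : Algebra.adjoin ℤ {y})
  exact hya.mul (hza.pow 2).inv

/-- `z` is a Laurent monomial in `x` and `y`. -/
def IsLaurentMonomial (x y z : ℝ) : Prop := ∃ a b : ℤ, z = x ^ a * y ^ b

namespace IsLaurentMonomial

variable {x y z w : ℝ}

theorem pos (hx : 0 < x) (hy : 0 < y) (h : IsLaurentMonomial x y z) : 0 < z := by
  obtain ⟨a, b, rfl⟩ := h
  positivity

theorem left (x y : ℝ) : IsLaurentMonomial x y x := ⟨1, 0, by simp⟩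

theorem right (x y : ℝ) : IsLaurentMonomial x y y := ⟨0, 1, by simp⟩

theorem one (x y : ℝ) : IsLaurentMonomial x y 1 := ⟨0, 0, by simp⟩

theorem mul (hx : 0 < x) (hy : 0 < y) (hz : IsLaurentMonomial x y z)
    (hw : IsLaurentMonomial x y w) : IsLaurentMonomial x y (z * w) := by
  obtain ⟨a, b, rfl⟩ := hz
  obtain ⟨c, d, rfl⟩ := hw
  refine ⟨a + c, b + d, ?_⟩
  rw [zpow_add₀ hx.ne', zpow_add₀ hy.ne']
  ring

theorem zpow (hz : IsLaurentMonomial x y z) (n : ℤ) : IsLaurentMonomial x y (z ^ n) := by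
  obtain ⟨a, b, rfl⟩ := hz
  exact ⟨a * n, b * n, by rw [mul_zpow, zpow_mul, zpow_mul]⟩

theorem pow (hz : IsLaurentMonomial x y z) (n : ℕ) : IsLaurentMonomial x y (z ^ n) := by
  simpa using hz.zpow n

theorem inv (hz : IsLaurentMonomial x y z) : IsLaurentMonomial x y z⁻¹ := by
  simpa using hz.zpow (-1)

theorem div (hx : 0 < x) (hy : 0 < y) (hz : IsLaurentMonomial x y z)
    (hw : IsLaurentMonomial x y w) : IsLaurentMonomial x y (z / w) := by
  rw [div_eq_mul_inv]
  exact hz.mul hx hy hw.inv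

theorem mem_closure (hz : IsLaurentMonomial x y z) : z ∈ Subfield.closure {x, y} := by
  obtain ⟨a, b, rfl⟩ := hz
  exact mul_mem (zpow_mem (Subfield.subset_closure (by simp)) a)
    (zpow_mem (Subfield.subset_closure (by simp)) b)

end IsLaurentMonomial

theorem zpow_eq_pow_toNat_div {K : Type*} [Field K] {u : K} (hu : u ≠ 0) (k : ℤ) :
    u ^ k = u ^ k.toNat / u ^ (-k).toNat := by
  rw [← zpow_natCast, ← zpow_natCast, ← zpow_sub₀ hu, Int.toNat_sub_toNat_neg]

theorem exists_isRelPrime_eq_div_of_mem_closure {x y f : ℝ} (hind : AlgebraicIndependent ℤ ![x, y])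
    (hf : f ∈ Subfield.closure {x, y}) (hf0 : f ≠ 0) :
    ∃ p q : MvPolynomial (Fin 2) ℤ, IsRelPrime p q ∧ p ≠ 0 ∧ q ≠ 0 ∧
      f = MvPolynomial.aeval ![x, y] p / MvPolynomial.aeval ![x, y] q := by
  have hmem : ∀ g ∈ Subring.closure {x, y}, ∃ p : MvPolynomial (Fin 2) ℤ,
      MvPolynomial.aeval ![x, y] p = g := by
    intro g hg
    induction hg using Subring.closure_induction with
    | mem g hg =>
      rcases hg with rfl | rfl
      · exact ⟨MvPolynomial.X 0, by simp⟩
      · exact ⟨MvPolynomial.X 1, by simp⟩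
    | zero => exact ⟨0, map_zero _⟩
    | one => exact ⟨1, map_one _⟩
    | add _ _ _ _ h₁ h₂ =>
      obtain ⟨⟨p, rfl⟩, ⟨q, rfl⟩⟩ := And.intro h₁ h₂
      exact ⟨p + q, map_add _ _ _⟩
    | neg _ _ h =>
      obtain ⟨p, rfl⟩ := h
      exact ⟨-p, map_neg _ _⟩
    | mul _ _ _ _ h₁ h₂ =>
      obtain ⟨⟨p, rfl⟩, ⟨q, rfl⟩⟩ := And.intro h₁ h₂
      exact ⟨p * q, map_mul _ _ _⟩
  obtain ⟨u, hu, v, hv, rfl⟩ := Subfield.mem_closure_iff.1 hf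
  obtain ⟨p, rfl⟩ := hmem u hu
  obtain ⟨q, rfl⟩ := hmem v hv
  have hp : p ≠ 0 := by rintro rfl; simp at hf0
  have hq : q ≠ 0 := by rintro rfl; simp at hf0
  obtain ⟨p', q', c, hrel, rfl, rfl⟩ := UniqueFactorizationMonoid.exists_reduced_factors p hp q
  refine ⟨p', q', hrel, right_ne_zero_of_mul hp, right_ne_zero_of_mul hq, ?_⟩
  have hc : MvPolynomial.aeval ![x, y] c ≠ 0 :=
    (map_ne_zero_iff _ hind).2 (left_ne_zero_of_mul hp)
  rw [map_mul, map_mul, mul_div_mul_left _ _ hc]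

theorem abs_aeval_eq_one_of_isUnit {x y : ℝ} {p : MvPolynomial (Fin 2) ℤ} (hp : IsUnit p) :
    |MvPolynomial.aeval ![x, y] p| = 1 := by
  obtain ⟨r, hr, rfl⟩ := MvPolynomial.isUnit_iff_eq_C_of_isReduced.1 hp
  rcases Int.isUnit_iff.1 hr with rfl | rfl <;> simp

theorem isLaurentMonomial_abs_aeval {x y : ℝ} (hx : 0 < x) (hy : 0 < y)
    (p : MvPolynomial (Fin 2) ℤ) (hp0 : p ≠ 0)
    (hp : ∀ P, Prime P → P ∣ p → P ∣ MvPolynomial.X 0 * MvPolynomial.X 1) :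
    IsLaurentMonomial x y |MvPolynomial.aeval ![x, y] p| := by
  induction p using UniqueFactorizationMonoid.induction_on_prime with
  | h₁ => exact absurd rfl hp0
  | h₂ p hu => simpa [abs_aeval_eq_one_of_isUnit hu] using IsLaurentMonomial.one x y
  | h₃ p P hp' hP ih =>
    rw [map_mul, abs_mul]
    refine IsLaurentMonomial.mul hx hy ?_ (ih hp' fun Q hQ hd => hp Q hQ (hd.mul_left P))
    have key : ∀ i : Fin 2, P ∣ MvPolynomial.X i →
        |MvPolynomial.aeval ![x, y] P| = ![x, y] i := by
      intro i hi
      obtain ⟨u, hu⟩ := hP.associated_of_dvd (MvPolynomial.X_prime (R := ℤ)) hi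
      have hi0 : 0 < ![x, y] i := by fin_cases i <;> simpa
      have := congrArg (fun q => |MvPolynomial.aeval ![x, y] q|) hu
      simpa [abs_mul, abs_aeval_eq_one_of_isUnit u.isUnit, abs_of_pos hi0] using this
    rcases hP.dvd_or_dvd (hp P hP (dvd_mul_right P p)) with h | h
    · simpa [key 0 h] using IsLaurentMonomial.left x y
    · simpa [key 1 h] using IsLaurentMonomial.right x y

theorem IsLaurentMonomial.exists_eq_div {x y γ : ℝ} (hx : 0 < x) (hy : 0 < y)
    (hγ : IsLaurentMonomial x y γ) {P : MvPolynomial (Fin 2) ℤ} (hP : Prime P)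
    (hPX : ¬ P ∣ MvPolynomial.X 0 * MvPolynomial.X 1) :
    ∃ s t : MvPolynomial (Fin 2) ℤ, ¬ P ∣ s ∧ ¬ P ∣ t ∧
      γ = MvPolynomial.aeval ![x, y] s / MvPolynomial.aeval ![x, y] t := by
  obtain ⟨a, b, rfl⟩ := hγ
  have hmon : ∀ i j : ℕ, ¬ P ∣ (MvPolynomial.X 0 ^ i * MvPolynomial.X 1 ^ j) := by
    intro i j h
    rcases hP.dvd_or_dvd h with h | h
    · exact hPX ((hP.dvd_of_dvd_pow h).mul_right _)
    · exact hPX ((hP.dvd_of_dvd_pow h).mul_left _)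
  refine ⟨_, _, hmon a.toNat b.toNat, hmon (-a).toNat (-b).toNat, ?_⟩
  rw [zpow_eq_pow_toNat_div hx.ne' a, zpow_eq_pow_toNat_div hy.ne' b]
  simp [div_mul_div_comm]

theorem pow_dvd_of_abs_eq {x y : ℝ} (hx : 0 < x) (hy : 0 < y)
    (hind : AlgebraicIndependent ℤ ![x, y]) {p q P : MvPolynomial (Fin 2) ℤ}
    (hp0 : p ≠ 0) (hrel : IsRelPrime p q) (hP : Prime P) (hPp : P ∣ p)
    (hPX : ¬ P ∣ MvPolynomial.X 0 * MvPolynomial.X 1) {m : ℕ} {h γ : ℝ}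
    (hm : 0 < m) (hh : h ∈ Subfield.closure {x, y}) (hγ : IsLaurentMonomial x y γ)
    (hq0 : q ≠ 0)
    (heq : |MvPolynomial.aeval ![x, y] p / MvPolynomial.aeval ![x, y] q| = |h| ^ m * γ) :
    P ^ m ∣ p := by
  have hev : ∀ {r : MvPolynomial (Fin 2) ℤ}, r ≠ 0 → MvPolynomial.aeval ![x, y] r ≠ 0 :=
    fun hr => (map_ne_zero_iff _ hind).2 hr
  have hh0 : h ≠ 0 := by
    rintro rfl
    rw [abs_zero, zero_pow hm.ne', zero_mul, abs_eq_zero] at heq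
    exact div_ne_zero (hev hp0) (hev hq0) heq
  obtain ⟨u, w, huw, hu0, hw0, rfl⟩ := exists_isRelPrime_eq_div_of_mem_closure hind hh hh0
  have hγ0 := hγ.pos hx hy
  obtain ⟨s, t, hs, ht, rfl⟩ := hγ.exists_eq_div hx hy hP hPX
  have ht0 : t ≠ 0 := by rintro rfl; exact ht (dvd_zero P)
  rw [← abs_of_pos hγ0, ← abs_pow, ← abs_mul, div_pow, div_mul_div_comm] at heq
  have heq' : p * (w ^ m * t) = q * (u ^ m * s) ∨ p * (w ^ m * t) = -(q * (u ^ m * s)) := by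
    rcases abs_eq_abs.1 heq with h | h
    · left
      apply hind
      rw [div_eq_div_iff (hev hq0) (mul_ne_zero (pow_ne_zero _ (hev hw0)) (hev ht0))] at h
      simp only [map_mul, map_pow]
      linear_combination h
    · right
      apply hind
      rw [← neg_div, div_eq_div_iff (hev hq0)
        (mul_ne_zero (pow_ne_zero _ (hev hw0)) (hev ht0))] at h
      simp only [map_mul, map_pow, map_neg]
      linear_combination h
  have hdvd : ∀ r, r ∣ p * (w ^ m * t) ↔ r ∣ q * (u ^ m * s) := by
    intro r
    rcases heq' with h | h <;> rw [h]
    rw [dvd_neg]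
  have hPu : P ∣ u := by
    rcases hP.dvd_or_dvd ((hdvd P).1 (hPp.mul_right _)) with h | h
    · exact absurd (hrel hPp h) hP.not_isUnit
    · rcases hP.dvd_or_dvd h with h | h
      · exact hP.dvd_of_dvd_pow h
      · exact absurd h hs
  have hPw : ¬ P ∣ w ^ m * t := by
    intro h
    rcases hP.dvd_or_dvd h with h | h
    · exact hP.not_isUnit (huw hPu (hP.dvd_of_dvd_pow h))
    · exact ht h
  exact hP.pow_dvd_of_dvd_mul_right m hPw
    ((hdvd _).2 (((pow_dvd_pow_of_dvd hPu m).mul_right s).mul_left q))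

/-- An element of `ℚ(x, y)` is, up to sign, a Laurent monomial in `x` and `y`, or the exponents of
which it is a power up to signs and Laurent monomials are bounded. -/
theorem isLaurentMonomial_abs_or_bounded {x y : ℝ} (hx : 0 < x) (hy : 0 < y)
    (hind : AlgebraicIndependent ℤ ![x, y]) {f : ℝ} (hf : f ∈ Subfield.closure {x, y})
    (hf0 : f ≠ 0) :
    IsLaurentMonomial x y |f| ∨ ∃ B : ℕ, ∀ m : ℕ, 0 < m → ∀ h ∈ Subfield.closure {x, y},
      ∀ γ, IsLaurentMonomial x y γ → |f| = |h| ^ m * γ → m ≤ B := by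
  obtain ⟨p, q, hrel, hp0, hq0, rfl⟩ := exists_isRelPrime_eq_div_of_mem_closure hind hf hf0
  have bound : ∀ p' P : MvPolynomial (Fin 2) ℤ, p' ≠ 0 → Prime P → ∃ B : ℕ, ∀ m : ℕ,
      P ^ m ∣ p' → m ≤ B := by
    intro p' P hp' hP
    obtain ⟨B, hB⟩ := FiniteMultiplicity.of_prime_left hP hp'
    exact ⟨B, fun m hm => by
      by_contra! hlt
      exact hB ((pow_dvd_pow P hlt).trans hm)⟩
  by_cases h₁ : ∀ P, Prime P → P ∣ p → P ∣ MvPolynomial.X 0 * MvPolynomial.X 1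
  · by_cases h₂ : ∀ P, Prime P → P ∣ q → P ∣ MvPolynomial.X 0 * MvPolynomial.X 1
    · left
      rw [abs_div]
      exact (isLaurentMonomial_abs_aeval hx hy p hp0 h₁).div hx hy
        (isLaurentMonomial_abs_aeval hx hy q hq0 h₂)
    · right
      push Not at h₂
      obtain ⟨P, hP, hPq, hPX⟩ := h₂
      obtain ⟨B, hB⟩ := bound q P hq0 hP
      refine ⟨B, fun m hm h hh γ hγ heq => hB m ?_⟩
      refine pow_dvd_of_abs_eq hx hy hind hq0 hrel.symm hP hPq hPX hm (inv_mem hh) hγ.inv hp0 ?_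
      rw [← inv_div, abs_inv, heq, mul_inv, abs_inv, inv_pow]
  · right
    push Not at h₁
    obtain ⟨P, hP, hPp, hPX⟩ := h₁
    obtain ⟨B, hB⟩ := bound p P hp0 hP
    exact ⟨B, fun m hm h hh γ hγ heq => hB m
      (pow_dvd_of_abs_eq hx hy hind hp0 hrel hP hPp hPX hm hh hγ hq0 heq)⟩

theorem isLaurentMonomial_abs_of_pow {x y : ℝ} (hx : 0 < x) (hy : 0 < y)
    (hind : AlgebraicIndependent ℤ ![x, y]) {f : ℝ} (hf : f ∈ Subfield.closure {x, y})
    {m : ℕ} (hm : 0 < m) (h : IsLaurentMonomial x y (|f| ^ m)) : IsLaurentMonomial x y |f| := by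
  have hf0 : f ≠ 0 := by
    rintro rfl
    simpa [hm.ne'] using h.pos hx hy
  refine (isLaurentMonomial_abs_or_bounded hx hy hind hf hf0).resolve_right ?_
  rintro ⟨B, hB⟩
  have hle := hB (1 + m * B) (by omega) f hf _ (h.pow B).inv (by
    rw [pow_add, pow_one, pow_mul, mul_assoc, mul_inv_cancel₀ (by positivity), mul_one])
  nlinarith

theorem AlgebraicIndependent.zpow_mul_zpow_eq_one {x y : ℝ} (hx : 0 < x) (hy : 0 < y)
    (hind : AlgebraicIndependent ℤ ![x, y]) {a b : ℤ} (h : x ^ a * y ^ b = 1) :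
    a = 0 ∧ b = 0 := by
  rw [zpow_eq_pow_toNat_div hx.ne' a, zpow_eq_pow_toNat_div hy.ne' b, div_mul_div_comm, div_eq_one_iff_eq (by positivity)] at h
  have hev : ∀ s : Fin 2 →₀ ℕ, MvPolynomial.aeval ![x, y] (MvPolynomial.monomial s (1 : ℤ)) =
      x ^ s 0 * y ^ s 1 := fun s => by simp [MvPolynomial.aeval_monomial, Finsupp.prod_fintype]
  let e : ℤ → ℤ → Fin 2 →₀ ℕ := fun i j => Finsupp.equivFunOnFinite.symm ![i.toNat, j.toNat]
  have hmon : MvPolynomial.monomial (e a b) (1 : ℤ) = MvPolynomial.monomial (e (-a) (-b)) 1 := by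
    apply hind
    rw [hev, hev]
    simpa [e] using h
  have he := MvPolynomial.monomial_left_injective one_ne_zero hmon
  have h0 := DFunLike.congr_fun he 0
  have h1 := DFunLike.congr_fun he 1
  simp [e] at h0 h1
  omega

theorem Subfield.eq_zero_or_eq_zero_of_pow_mem {K : Subfield ℝ} {θ a b : ℝ} (hθ : θ ^ 2 ∈ K)
    (hθK : θ ∉ K) (ha : a ∈ K) (hb : b ∈ K) {m : ℕ} (hm : 0 < m) (h : (a + b * θ) ^ m ∈ K) :
    a = 0 ∨ b = 0 := by
  have conj : ∀ n : ℕ, ∃ c ∈ K, ∃ d ∈ K, (a + b * θ) ^ n = c + d * θ ∧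
      (a - b * θ) ^ n = c - d * θ := by
    intro n
    induction n with
    | zero => exact ⟨1, one_mem _, 0, zero_mem _, by simp, by simp⟩
    | succ n ih =>
      obtain ⟨c, hc, d, hd, h₁, h₂⟩ := ih
      refine ⟨c * a + d * b * θ ^ 2,
        add_mem (mul_mem hc ha) (mul_mem (mul_mem hd hb) hθ),
        c * b + d * a, add_mem (mul_mem hc hb) (mul_mem hd ha), ?_, ?_⟩
      · rw [pow_succ, h₁]; ring
      · rw [pow_succ, h₂]; ring
  obtain ⟨c, hc, d, hd, h₁, h₂⟩ := conj m
  have hd0 : d = 0 := by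
    by_contra hd0
    refine hθK ?_
    have : θ = ((a + b * θ) ^ m - c) / d := by rw [h₁]; field_simp; ring
    rw [this]
    exact div_mem (sub_mem h hc) hd
  have habs : |a + b * θ| = |a - b * θ| := by
    refine (pow_left_inj₀ (abs_nonneg _) (abs_nonneg _) hm.ne').1 ?_
    rw [← abs_pow, ← abs_pow, h₁, h₂, hd0, zero_mul, add_zero, sub_zero]
  have hθ0 : θ ≠ 0 := fun h0 => hθK (h0 ▸ zero_mem K)
  rcases abs_eq_abs.1 habs with h | h
  · right
    have : b * θ = 0 := by linarith
    exact (mul_eq_zero.1 this).resolve_right hθ0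
  · left
    linarith

theorem Subfield.exists_eq_add_mul_of_mem_closure {K : Subfield ℝ} {θ : ℝ} (hθ : θ ^ 2 ∈ K)
    (hθK : θ ∉ K) {s : Set ℝ} (hs : ∀ g ∈ s, ∃ a ∈ K, ∃ b ∈ K, g = a + b * θ) {g : ℝ}
    (hg : g ∈ Subfield.closure s) : ∃ a ∈ K, ∃ b ∈ K, g = a + b * θ := by
  induction hg using Subfield.closure_induction with
  | mem g hg => exact hs g hg
  | one => exact ⟨1, one_mem _, 0, zero_mem _, by simp⟩
  | add _ _ _ _ h₁ h₂ =>
    obtain ⟨⟨a, ha, b, hb, rfl⟩, ⟨c, hc, d, hd, rfl⟩⟩ := And.intro h₁ h₂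
    exact ⟨a + c, add_mem ha hc, b + d, add_mem hb hd, by ring⟩
  | neg _ _ h =>
    obtain ⟨a, ha, b, hb, rfl⟩ := h
    exact ⟨-a, neg_mem ha, -b, neg_mem hb, by ring⟩
  | inv _ _ h =>
    obtain ⟨a, ha, b, hb, rfl⟩ := h
    have hN : a ^ 2 - b ^ 2 * θ ^ 2 ∈ K := sub_mem (pow_mem ha 2) (mul_mem (pow_mem hb 2) hθ)
    refine ⟨a / (a ^ 2 - b ^ 2 * θ ^ 2), div_mem ha hN, -b / (a ^ 2 - b ^ 2 * θ ^ 2),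
      div_mem (neg_mem hb) hN, ?_⟩
    by_cases hb0 : b = 0
    · subst hb0
      by_cases ha0 : a = 0
      · simp [ha0]
      · simp [sq]
    · have h₁ : a + b * θ ≠ 0 := by
        intro h0
        refine hθK ?_
        rw [show θ = -a / b by field_simp; linarith]
        exact div_mem (neg_mem ha) hb
      have h₂ : a - b * θ ≠ 0 := by
        intro h0
        refine hθK ?_
        rw [show θ = a / b by field_simp; linarith]
        exact div_mem ha hb
      have h₃ : a ^ 2 - b ^ 2 * θ ^ 2 ≠ 0 := by
        rw [show a ^ 2 - b ^ 2 * θ ^ 2 = (a + b * θ) * (a - b * θ) by ring]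
        exact mul_ne_zero h₁ h₂
      field_simp
      ring
  | mul _ _ _ _ h₁ h₂ =>
    obtain ⟨⟨a, ha, b, hb, rfl⟩, ⟨c, hc, d, hd, rfl⟩⟩ := And.intro h₁ h₂
    exact ⟨a * c + b * d * θ ^ 2, add_mem (mul_mem ha hc) (mul_mem (mul_mem hb hd) hθ),
      a * d + b * c, add_mem (mul_mem ha hd) (mul_mem hb hc), by ring⟩

/-- A real sequence of positive terms with `r (n + 2) ^ 2 = r (n + 1) / r n` whose first two terms
are algebraically independent. -/
structure IsSqrtRatioSeq (r : ℕ → ℝ) : Prop where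
  pos : ∀ n, 0 < r n
  sq_eq : ∀ n, r (n + 2) ^ 2 = r (n + 1) / r n
  indep_zero : AlgebraicIndependent ℤ ![r 0, r 1]

theorem exists_isSqrtRatioSeq : ∃ r : ℕ → ℝ, IsSqrtRatioSeq r := by
  obtain ⟨x, y, hx, hy, hind⟩ := exists_pos_algebraicIndependent_pair
  let F : ℝ × ℝ → ℝ × ℝ := fun p => (p.2, √(p.2 / p.1))
  let s : ℕ → ℝ × ℝ := fun n => F^[n] (x, y)
  have hs : ∀ n, s (n + 1) = F (s n) := fun n => Function.iterate_succ_apply' F n _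
  have hpos : ∀ n, 0 < (s n).1 ∧ 0 < (s n).2 := by
    intro n
    induction n with
    | zero => exact ⟨hx, hy⟩
    | succ n ih =>
      rw [hs]
      exact ⟨ih.2, Real.sqrt_pos.2 (div_pos ih.2 ih.1)⟩
  have hfst : ∀ n, (s (n + 1)).1 = (s n).2 := fun n => by rw [hs]
  refine ⟨fun n => (s n).1, fun n => (hpos n).1, fun n => ?_, hind⟩
  change (s (n + 1 + 1)).1 ^ 2 = (s (n + 1)).1 / (s n).1
  rw [hfst (n + 1), hfst n, hs]
  exact Real.sq_sqrt (div_pos (hpos n).2 (hpos n).1).le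

namespace IsSqrtRatioSeq

variable {r : ℕ → ℝ}

theorem indep (hr : IsSqrtRatioSeq r) (n : ℕ) : AlgebraicIndependent ℤ ![r n, r (n + 1)] := by
  induction n with
  | zero => exact hr.indep_zero
  | succ n ih => exact ih.pair_sqrt_div (hr.pos n).ne' (hr.pos _).ne' (hr.sq_eq n)

theorem eq_mul_zpow (hr : IsSqrtRatioSeq r) (n : ℕ) : r n = r (n + 1) * r (n + 2) ^ (-2 : ℤ) := by
  have h₀ := (hr.pos n).ne'
  have h₁ := (hr.pos (n + 1)).ne'
  rw [zpow_neg, zpow_ofNat, hr.sq_eq]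
  field_simp

theorem zpow_mul_zpow (hr : IsSqrtRatioSeq r) (n : ℕ) (a b : ℤ) :
    r n ^ a * r (n + 1) ^ b = r (n + 1) ^ (a + b) * r (n + 2) ^ (-2 * a) := by
  rw [hr.eq_mul_zpow n, mul_zpow, ← zpow_mul, zpow_add₀ (hr.pos _).ne']
  ring

theorem isLaurentMonomial_mono (hr : IsSqrtRatioSeq r) {n k : ℕ} (hnk : n ≤ k) {z : ℝ}
    (hz : IsLaurentMonomial (r n) (r (n + 1)) z) : IsLaurentMonomial (r k) (r (k + 1)) z := by
  induction k, hnk using Nat.le_induction with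
  | base => exact hz
  | succ k _ ih =>
    obtain ⟨a, b, rfl⟩ := ih
    exact ⟨_, _, hr.zpow_mul_zpow k a b⟩

theorem closure_mono (hr : IsSqrtRatioSeq r) :
    Monotone fun n => Subfield.closure {r n, r (n + 1)} := by
  refine monotone_nat_of_le_succ fun n => Subfield.closure_le.2 ?_
  have h : ∀ z, IsLaurentMonomial (r n) (r (n + 1)) z →
      z ∈ Subfield.closure {r (n + 1), r (n + 1 + 1)} :=
    fun z hz => (hr.isLaurentMonomial_mono n.le_succ hz).mem_closure
  rintro _ (rfl | rfl)
  · exact h _ (.left _ _)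
  · exact h _ (.right _ _)

theorem exists_pow_isLaurentMonomial (hr : IsSqrtRatioSeq r) {n k : ℕ} (hnk : n ≤ k) {z : ℝ}
    (hz : IsLaurentMonomial (r k) (r (k + 1)) z) :
    ∃ M : ℕ, 0 < M ∧ IsLaurentMonomial (r n) (r (n + 1)) (z ^ M) := by
  induction k, hnk using Nat.le_induction generalizing z with
  | base => exact ⟨1, one_pos, by simpa⟩
  | succ k _ ih =>
    have hsq : IsLaurentMonomial (r k) (r (k + 1)) (z ^ 2) := by
      obtain ⟨a, b, rfl⟩ := hz
      refine ⟨-b, 2 * a + b, ?_⟩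
      rw [mul_pow, ← zpow_natCast (r (k + 1 + 1) ^ b), zpow_comm, zpow_natCast, hr.sq_eq,
        zpow_add₀ (hr.pos _).ne', zpow_neg, div_zpow, mul_comm 2 a, zpow_mul]
      field_simp
    obtain ⟨M, hM, h⟩ := ih hsq
    exact ⟨2 * M, by omega, by rwa [pow_mul]⟩

theorem exists_eq_mul_of_pow_mem (hr : IsSqrtRatioSeq r) {n k : ℕ} (hnk : n ≤ k) {g : ℝ}
    (hg : g ∈ Subfield.closure {r k, r (k + 1)}) {m : ℕ} (hm : 0 < m)
    (hgm : g ^ m ∈ Subfield.closure {r n, r (n + 1)}) :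
    ∃ h ∈ Subfield.closure {r n, r (n + 1)}, ∃ γ, IsLaurentMonomial (r k) (r (k + 1)) γ ∧
      g = h * γ := by
  induction k, hnk using Nat.le_induction generalizing g m with
  | base => exact ⟨g, hg, 1, .one _ _, by simp⟩
  | succ k hnk ih =>
    set K := Subfield.closure {r k, r (k + 1)} with hK
    have lift : ∀ g', g' ∈ K → ∀ m' : ℕ, 0 < m' → g' ^ m' ∈ Subfield.closure {r n, r (n + 1)} →
        ∃ h ∈ Subfield.closure {r n, r (n + 1)}, ∃ γ,
          IsLaurentMonomial (r (k + 1)) (r (k + 1 + 1)) γ ∧ g' = h * γ := by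
      intro g' hg' m' hm' hgm'
      obtain ⟨h, hh, γ, hγ, rfl⟩ := ih hg' hm' hgm'
      exact ⟨h, hh, γ, hr.isLaurentMonomial_mono k.le_succ hγ, rfl⟩
    have h₀ : r k ∈ K := Subfield.subset_closure (by simp)
    have h₁ : r (k + 1) ∈ K := Subfield.subset_closure (by simp)
    by_cases hθK : r (k + 2) ∈ K
    · refine lift g (Subfield.closure_le.2 ?_ hg) m hm hgm
      rintro _ (rfl | rfl)
      exacts [h₁, hθK]
    have hθ : r (k + 2) ^ 2 ∈ K := hr.sq_eq k ▸ div_mem h₁ h₀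
    obtain ⟨a, ha, b, hb, rfl⟩ := Subfield.exists_eq_add_mul_of_mem_closure hθ hθK (by
      rintro _ (rfl | rfl)
      · exact ⟨_, h₁, 0, zero_mem _, by simp⟩
      · exact ⟨0, zero_mem _, 1, one_mem _, by simp⟩) hg
    rcases Subfield.eq_zero_or_eq_zero_of_pow_mem hθ hθK ha hb hm
      (hr.closure_mono hnk hgm) with rfl | rfl
    · have hlm : IsLaurentMonomial (r (k + 1)) (r (k + 1 + 1)) (r (k + 2)) := .right _ _
      obtain ⟨M, hM, hθM⟩ := hr.exists_pow_isLaurentMonomial (hnk.trans k.le_succ) hlm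
      obtain ⟨h, hh, γ, hγ, rfl⟩ := lift b hb (m * M) (by positivity) (by
        have : b ^ (m * M) = ((0 + b * r (k + 2)) ^ m) ^ M / (r (k + 2) ^ M) ^ m := by
          have := (hr.pos (k + 2)).ne'
          rw [zero_add, eq_div_iff (by positivity), ← pow_mul, ← pow_mul, mul_comm M m, mul_pow]
        rw [this]
        exact div_mem (pow_mem hgm M) (pow_mem hθM.mem_closure m))
      exact ⟨h, hh, _, hγ.mul (hr.pos _) (hr.pos _) hlm, by ring⟩
    · simp only [zero_mul, add_zero] at hgm ⊢
      exact lift a ha m hm hgm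

theorem zpow_mul_zpow_inj (hr : IsSqrtRatioSeq r) {n : ℕ} {a b c d : ℤ}
    (h : r n ^ a * r (n + 1) ^ b = r n ^ c * r (n + 1) ^ d) : a = c ∧ b = d := by
  have h₀ := (hr.pos n).ne'
  have h₁ := (hr.pos (n + 1)).ne'
  have h' : r n ^ (a - c) * r (n + 1) ^ (b - d) = 1 := by
    rw [zpow_sub₀ h₀, zpow_sub₀ h₁, div_mul_div_comm, h, div_self (by positivity)]
  have := (hr.indep n).zpow_mul_zpow_eq_one (hr.pos _) (hr.pos _) h'
  omega

/-- The number `b ^ 2 + a * b + 2 * a ^ 2` is the norm of `a * ω + b` where `ω ^ 2 = ω - 2`;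
passing from level `n` to level `n + 1` is multiplication by `ω`. -/
theorem dvd_norm_of_pow_eq (hr : IsSqrtRatioSeq r) {n k : ℕ} (hnk : n ≤ k) {a b : ℤ} {m : ℕ} {δ : ℝ}
    (hδ : IsLaurentMonomial (r k) (r (k + 1)) δ) (h : δ ^ m = r n ^ a * r (n + 1) ^ b) :
    (m : ℤ) ∣ b ^ 2 + a * b + 2 * a ^ 2 := by
  have key : ∃ s t : ℤ, IsCoprime s t ∧ IsCoprime (s + t) 2 ∧ r n ^ a * r (n + 1) ^ b =
      r k ^ (a * s + a * t + b * s) * r (k + 1) ^ (b * t - 2 * (a * s)) := by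
    clear h hδ
    induction k, hnk using Nat.le_induction with
    | base => exact ⟨0, 1, isCoprime_one_right, by simp, by simp⟩
    | succ k _ ih =>
      obtain ⟨s, t, hst, h2, h⟩ := ih
      refine ⟨s + t, -2 * s, ?_, ?_, ?_⟩
      · have hs : IsCoprime (s + t) s := by
          simpa [add_comm] using (IsCoprime.add_mul_left_left hst.symm 1)
        exact h2.neg_right.mul_right hs
      · have := h2.add_mul_left_left (-s)
        rwa [show s + t + -2 * s = s + t + 2 * -s by ring]
      · rw [h, hr.zpow_mul_zpow]
        congr 2 <;> ring
  obtain ⟨s, t, ⟨u, v, huv⟩, -, hA⟩ := key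
  obtain ⟨c, d, rfl⟩ := hδ
  rw [hA, mul_pow, ← zpow_natCast, ← zpow_natCast, ← zpow_mul, ← zpow_mul] at h
  obtain ⟨h₁, h₂⟩ := hr.zpow_mul_zpow_inj h
  refine ⟨u * (b * c - a * d) + v * (2 * a * c + (a + b) * d), ?_⟩
  linear_combination (u * b + 2 * v * a) * -h₁ + (-u * a + v * (a + b)) * -h₂ -
    (b ^ 2 + a * b + 2 * a ^ 2) * huv

theorem exists_bound_of_isLaurentMonomial (hr : IsSqrtRatioSeq r) {n : ℕ} {γ : ℝ}
    (hγ : IsLaurentMonomial (r n) (r (n + 1)) γ) (hγ1 : γ ≠ 1) :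
    ∃ B : ℕ, ∀ k, n ≤ k → ∀ δ, IsLaurentMonomial (r k) (r (k + 1)) δ → ∀ m : ℕ,
      δ ^ m = γ → m ≤ B := by
  obtain ⟨a, b, rfl⟩ := hγ
  have hq : b ^ 2 + a * b + 2 * a ^ 2 ≠ 0 := by
    intro h
    have ha : a = 0 := by
      have : 7 * a ^ 2 ≤ 0 := by nlinarith [sq_nonneg (2 * b + a)]
      exact pow_eq_zero_iff two_ne_zero |>.1 (by nlinarith [sq_nonneg a])
    subst ha
    have hb : b = 0 := by simpa using h
    subst hb
    simp at hγ1
  refine ⟨(b ^ 2 + a * b + 2 * a ^ 2).natAbs, fun k hnk δ hδ m h => ?_⟩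
  exact Nat.le_of_dvd (Int.natAbs_pos.2 hq)
    (Int.natCast_dvd.1 (hr.dvd_norm_of_pow_eq hnk hδ h))

/-- The field generated by the terms of the sequence. -/
noncomputable def field (_ : IsSqrtRatioSeq r) : Subfield ℝ := ⨆ n, Subfield.closure {r n, r (n + 1)}

theorem mem_field (hr : IsSqrtRatioSeq r) {g : ℝ} :
    g ∈ hr.field ↔ ∃ n, g ∈ Subfield.closure {r n, r (n + 1)} :=
  Subfield.mem_iSup_of_directed hr.closure_mono.directed_le

theorem term_mem_field (hr : IsSqrtRatioSeq r) (n : ℕ) : r n ∈ hr.field :=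
  hr.mem_field.2 ⟨n, Subfield.subset_closure (by simp)⟩

theorem exists_bound_of_abs_pow_eq (hr : IsSqrtRatioSeq r) {f : ℝ} (hf : f ∈ hr.field)
    (hf0 : f ≠ 0) (hf1 : |f| ≠ 1) :
    ∃ B : ℕ, ∀ m : ℕ, 0 < m → ∀ g ∈ hr.field, |g| ^ m = |f| → m ≤ B := by
  obtain ⟨n, hfn⟩ := hr.mem_field.1 hf
  have hx := hr.pos n
  have hy := hr.pos (n + 1)
  have hind := hr.indep n
  have factor : ∀ m : ℕ, 0 < m → ∀ g ∈ hr.field, |g| ^ m = |f| →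
      ∃ k, n ≤ k ∧ ∃ h ∈ Subfield.closure {r n, r (n + 1)}, ∃ γ,
        IsLaurentMonomial (r k) (r (k + 1)) γ ∧ |g| = |h| * γ ∧
        IsLaurentMonomial (r n) (r (n + 1)) (γ ^ m) ∧ |f| = |h| ^ m * γ ^ m := by
    intro m hm g hg hgm
    obtain ⟨k₀, hgk₀⟩ := hr.mem_field.1 hg
    have hnk := le_max_left n k₀
    have hgk := hr.closure_mono (le_max_right n k₀) hgk₀
    set k := max n k₀
    have hgmem : g ^ m ∈ Subfield.closure {r n, r (n + 1)} := by
      rw [← abs_pow] at hgm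
      rcases abs_eq_abs.1 hgm with h | h <;> rw [h]
      exacts [hfn, neg_mem hfn]
    obtain ⟨h, hh, γ, hγ, rfl⟩ := hr.exists_eq_mul_of_pow_mem hnk hgk hm hgmem
    have hγ0 := hγ.pos (hr.pos _) (hr.pos _)
    have hh0 : h ≠ 0 := by
      rintro rfl
      rw [zero_mul, abs_zero, zero_pow hm.ne'] at hgm
      exact hf0 (abs_eq_zero.1 hgm.symm)
    rw [abs_mul, abs_of_pos hγ0] at hgm ⊢
    refine ⟨k, hnk, h, hh, γ, hγ, rfl, ?_, by rw [← hgm, mul_pow]⟩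
    have hγmem : γ ^ m ∈ Subfield.closure {r n, r (n + 1)} := by
      have : γ ^ m = (h * γ) ^ m / h ^ m := by
        rw [mul_pow, mul_div_cancel_left₀ _ (pow_ne_zero m hh0)]
      rw [this]
      exact div_mem hgmem (pow_mem hh m)
    obtain ⟨M, hM, hγM⟩ := hr.exists_pow_isLaurentMonomial hnk (hγ.pow m)
    rw [← abs_of_pos (pow_pos hγ0 m)] at hγM ⊢
    exact isLaurentMonomial_abs_of_pow hx hy hind hγmem hM hγM
  rcases isLaurentMonomial_abs_or_bounded hx hy hind hfn hf0 with hlm | ⟨B, hB⟩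
  · obtain ⟨B, hB⟩ := hr.exists_bound_of_isLaurentMonomial hlm hf1
    refine ⟨B, fun m hm g hg hgm => ?_⟩
    obtain ⟨k, hnk, h, hh, γ, hγ, hgh, hγm, hfh⟩ := factor m hm g hg hgm
    have hγ0 := hγ.pos (hr.pos _) (hr.pos _)
    have hhm : IsLaurentMonomial (r n) (r (n + 1)) (|h| ^ m) := by
      rw [show |h| ^ m = |f| / γ ^ m by rw [hfh]; field_simp]
      exact hlm.div hx hy hγm
    have hhk := hr.isLaurentMonomial_mono hnk (isLaurentMonomial_abs_of_pow hx hy hind hh hm hhm)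
    exact hB k hnk |g| (hgh ▸ hhk.mul (hr.pos _) (hr.pos _) hγ) m hgm
  · refine ⟨B, fun m hm g hg hgm => ?_⟩
    obtain ⟨k, -, h, hh, γ, -, -, hγm, hfh⟩ := factor m hm g hg hgm
    exact hB m hm h hh _ hγm hfh

theorem rootlessModtorField (hr : IsSqrtRatioSeq r) : RootlessModtorField hr.field := by
  intro f hf0 hf1
  have habs : |(f : ℝ)| ≠ 1 := by
    refine fun h => hf1 ⟨2, two_pos, Subtype.ext ?_⟩
    change (f : ℝ) ^ 2 = 1
    rw [← sq_abs, h, one_pow]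
  obtain ⟨B, hB⟩ := hr.exists_bound_of_abs_pow_eq f.2 (by simpa using hf0) habs
  refine (Set.finite_Iic B).subset ?_
  rintro m ⟨hm, ζ, g, ⟨n, hn, hζ⟩, hg⟩
  refine hB m hm g g.2 ?_
  have hζ' : |(ζ : ℝ)| = 1 := by
    refine (pow_eq_one_iff_of_nonneg (abs_nonneg _) hn.ne').1 ?_
    rw [← abs_pow, ← SubmonoidClass.coe_pow, hζ]
    simp
  rw [← abs_pow, ← SubmonoidClass.coe_pow, hg, Subfield.coe_mul, abs_mul, hζ', one_mul]

end IsSqrtRatioSeq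

theorem eq_zero_of_two_mul_eq_sub {l : ℕ → ℤ} (h : ∀ n, 2 * l (n + 2) = l (n + 1) - l n) :
    l 0 = 0 := by
  let Q : ℕ → ℤ := fun n => l n ^ 2 - l n * l (n + 1) + 2 * l (n + 1) ^ 2
  have hQ : ∀ n, Q 0 = 2 ^ n * Q n := by
    intro n
    induction n with
    | zero => simp
    | succ n ih =>
      rw [ih]
      have hn : l n = l (n + 1) - 2 * l (n + 2) := by linarith [h n]
      simp only [Q, hn]
      ring
  have hQ0 : Q 0 = 0 := by
    by_contra h0
    have hle := Int.le_of_dvd (abs_pos.2 h0) ((dvd_abs _ _).2 ⟨_, hQ (Q 0).natAbs⟩)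
    have hlt : ((Q 0).natAbs : ℤ) < 2 ^ (Q 0).natAbs := by exact_mod_cast Nat.lt_two_pow_self
    rw [Int.natCast_natAbs] at hlt
    exact hlt.not_ge hle
  have : 7 * l 0 ^ 2 ≤ 0 := by
    simp only [Q] at hQ0
    nlinarith [sq_nonneg (4 * l 1 - l 0)]
  exact pow_eq_zero_iff two_ne_zero |>.1 (by nlinarith [sq_nonneg (l 0)])

theorem Module.Free.eq_zero_of_two_smul_eq_sub {A : Type*} [AddCommGroup A] [Module.Free ℤ A]
    {v : ℕ → A} (h : ∀ n, (2 : ℤ) • v (n + 2) = v (n + 1) - v n) : v 0 = 0 := by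
  let b := Module.Free.chooseBasis ℤ A
  refine b.ext_elem fun i => ?_
  rw [map_zero, Finsupp.zero_apply]
  refine eq_zero_of_two_mul_eq_sub (l := fun n => b.repr (v n) i) fun n => ?_
  have := congrArg (fun a => b.repr a i) (h n)
  simpa using this

theorem IsSqrtRatioSeq.not_free {r : ℕ → ℝ} (hr : IsSqrtRatioSeq r) :
    ¬ Module.Free ℤ (Additive (hr.fieldˣ ⧸ CommGroup.torsion hr.fieldˣ)) := by
  intro hfree
  let u : ℕ → hr.fieldˣ := fun n => Units.mk0 ⟨r n, hr.term_mem_field n⟩ (by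
    simpa [Subtype.ext_iff] using (hr.pos n).ne')
  have hu : ∀ n, u (n + 2) ^ 2 = u (n + 1) / u n := fun n =>
    Units.ext (Subtype.ext (by simpa [u] using hr.sq_eq n))
  have h0 := Module.Free.eq_zero_of_two_smul_eq_sub (v := fun n => Additive.ofMul
    (QuotientGroup.mk (u n) : hr.fieldˣ ⧸ CommGroup.torsion hr.fieldˣ)) fun n => by
      rw [← ofMul_zpow, ← ofMul_div, ← QuotientGroup.mk_zpow, ← QuotientGroup.mk_div, ← hu]
      rfl
  rw [ofMul_eq_zero, QuotientGroup.eq_one_iff] at h0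
  obtain ⟨m, hm, h⟩ := isOfFinOrder_iff_pow_eq_one.1 h0
  have hm' : r 0 ^ m = 1 := by
    simpa [u] using congrArg (fun w : hr.fieldˣ => ((w : hr.field) : ℝ)) h
  have := (hr.zpow_mul_zpow_inj (n := 0) (a := m) (b := 0) (c := 0) (d := 0)
    (by simpa using hm')).1
  omega

/-- There is a rootless modtor field whose multiplicative group is not free modulo
torsion. -/
theorem stmt18 :
    ∃ (F : Type) (_ : Field F),
      RootlessModtorField F ∧
      ¬ Module.Free ℤ (Additive (Fˣ ⧸ CommGroup.torsion Fˣ)) := by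
  obtain ⟨r, hr⟩ := exists_isSqrtRatioSeq
  exact ⟨hr.field, inferInstance, hr.rootlessModtorField, hr.not_free⟩
end

section
/- There exists a field F that is rootless but not rootless modtor. -/
open Polynomial

/-- An element of finite order coprime to `n` is an `n`-th power. -/
lemma exists_pow_eq_of_coprime {M : Type*} [Monoid M] {x : M} {T n : ℕ} (hx : x ^ T = 1)
    (h : n.Coprime T) : ∃ y, y ^ n = x := by
  obtain ⟨m, hm⟩ := exists_pow_eq_self_of_coprime
    (h.coprime_dvd_right (orderOf_dvd_of_pow_eq_one hx))
  exact ⟨x ^ m, by rw [← pow_mul, mul_comm, pow_mul, hm]⟩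

/-- If a coprime power of `x` is an `n`-th power, then so is `x`. -/
lemma exists_pow_eq_of_pow_eq_pow {G : Type*} [CommGroup G] {x y : G} {P n : ℕ}
    (h : P.Coprime n) (hxy : x ^ P = y ^ n) : ∃ z, z ^ n = x := by
  refine ⟨y ^ P.gcdA n * x ^ P.gcdB n, ?_⟩
  have hb := Nat.gcd_eq_gcd_ab P n
  rw [h.gcd_eq_one] at hb
  calc (y ^ P.gcdA n * x ^ P.gcdB n) ^ n
      = (y ^ n) ^ P.gcdA n * (x ^ n) ^ P.gcdB n := by
        rw [mul_pow, ← zpow_natCast, ← zpow_natCast, ← zpow_natCast, ← zpow_natCast,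
          zpow_comm y, zpow_comm x]
    _ = x ^ ((P : ℤ) * P.gcdA n + n * P.gcdB n) := by
        rw [← hxy, zpow_add, zpow_mul, zpow_mul, zpow_natCast, zpow_natCast]
    _ = x := by rw [← hb]; simp

/-- Multiplicities of nonzero roots are bounded below by `n` if, after a separable monomial
substitution, the polynomial becomes an `n`-th power up to coprime factors. -/
lemma le_rootMultiplicity_of_comp_mul_pow_eq {k : Type*} [Field k] [IsAlgClosed k]
    {f g q r : k[X]} {e n : ℕ} {c β : k} (he : (e : k) ≠ 0) (hc : c ≠ 0) (hf : f ≠ 0)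
    (hq : q ≠ 0) (hr : r ≠ 0) (hβ : β ≠ 0) (hfβ : f.IsRoot β) (hgβ : ¬ g.IsRoot β)
    (h : f.comp (C c * X ^ e) * q ^ n = g.comp (C c * X ^ e) * r ^ n) :
    n ≤ f.rootMultiplicity β := by
  classical
  have he0 : e ≠ 0 := by rintro rfl; simp at he
  obtain ⟨γ, hγ⟩ := IsAlgClosed.exists_pow_nat_eq (c⁻¹ * β) (Nat.pos_of_ne_zero he0)
  have hγ' : c * γ ^ e = β := by rw [hγ, mul_inv_cancel_left₀ hc]
  have hγ0 : γ ≠ 0 := by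
    rintro rfl
    simp [he0] at hγ'
    exact hβ hγ'.symm
  obtain ⟨f₁, hf₁, hnd⟩ := exists_eq_pow_rootMultiplicity_mul_and_not_dvd f hf β
  have hf₁β : f₁.eval β ≠ 0 := fun h0 => hnd (dvd_iff_isRoot.2 h0)
  have hgc : (g.comp (C c * X ^ e)).eval γ ≠ 0 := by
    simpa [eval_comp, hγ'] using hgβ
  have hfc : (f₁.comp (C c * X ^ e)).eval γ ≠ 0 := by
    simpa [eval_comp, hγ'] using hf₁β
  have hl : eval γ (derivative (C c * X ^ e - C β)) ≠ 0 := by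
    simp [derivative_X_pow, hc, he, hγ0]
  have hl0 : (C c * X ^ e - C β) ≠ 0 := by
    intro h0; rw [h0] at hl; simp at hl
  have hl1 : rootMultiplicity γ (C c * X ^ e - C β) = 1 := by
    apply le_antisymm
    · by_contra! hlt
      exact hl ((one_lt_rootMultiplicity_iff_isRoot hl0).1 hlt).2
    · exact (rootMultiplicity_pos hl0).2 (by simp [hγ'])
  have hfcomp : f.comp (C c * X ^ e)
      = (C c * X ^ e - C β) ^ rootMultiplicity β f * f₁.comp (C c * X ^ e) := by
    conv_lhs => rw [hf₁]
    simp
  have key := congrArg (rootMultiplicity γ) h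
  have hf₁0 : f₁.comp (C c * X ^ e) ≠ 0 := by rintro h0; simp [h0] at hfc
  have hg0 : g.comp (C c * X ^ e) ≠ 0 := by rintro h0; simp [h0] at hgc
  simp only [← count_roots] at key hl1
  rw [hfcomp, roots_mul (by positivity), roots_mul (by positivity), roots_mul (by positivity)]
    at key
  simp only [roots_pow, Multiset.count_add, Multiset.count_nsmul, hl1] at key
  have h1 : Multiset.count γ (f₁.comp (C c * X ^ e)).roots = 0 := by
    rw [count_roots]; exact rootMultiplicity_eq_zero hfc
  have h2 : Multiset.count γ (g.comp (C c * X ^ e)).roots = 0 := by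
    rw [count_roots]; exact rootMultiplicity_eq_zero hgc
  rw [h1, h2] at key
  have hpos : 0 < rootMultiplicity β f := (rootMultiplicity_pos hf).2 hfβ
  refine Nat.le_of_dvd hpos ((Nat.dvd_add_left (dvd_mul_right n (q.roots.count γ))).1 ?_)
  exact ⟨_, by simpa using key⟩

/-- A polynomial is a monomial or has a nonzero root in an algebraically closed extension. -/
lemma eq_monomial_or_exists_root {K k : Type*} [Field K] [Field k] [IsAlgClosed k] [Algebra K k]
    {f : K[X]} (hf : f ≠ 0) :
    (∃ c i, c ≠ 0 ∧ f = C c * X ^ i) ∨ ∃ β : k, β ≠ 0 ∧ aeval β f = 0 := by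
  obtain ⟨f₁, hf₁, hnd⟩ := exists_eq_pow_rootMultiplicity_mul_and_not_dvd f hf 0
  rw [C_0, sub_zero] at hf₁ hnd
  by_cases hd : f₁.degree = 0
  · left
    rw [eq_C_of_degree_eq_zero hd] at hf₁ hnd
    refine ⟨_, _, ?_, hf₁.trans (mul_comm _ _)⟩
    intro h0
    simp [h0] at hnd
  · right
    obtain ⟨β, hβ⟩ := IsAlgClosed.exists_aeval_eq_zero k f₁ hd
    refine ⟨β, ?_, by rw [hf₁]; simp [hβ]⟩
    rintro rfl
    exact hnd (X_dvd_iff.2 (by simpa [← coeff_zero_eq_aeval_zero'] using hβ))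

/-- If `n` divides `D` times a product of distinct primes, and all of those primes dividing `n`
divide `N`, then `n` divides `D * N`. -/
lemma dvd_mul_of_dvd_mul_prod_primes {ι : Type*} {n D N : ℕ} {ℓ : ι → ℕ}
    (hℓ : ∀ i, (ℓ i).Prime) (hinj : Function.Injective ℓ) (s : Finset ι)
    (h : n ∣ D * ∏ i ∈ s, ℓ i) (hN : ∀ i ∈ s, ℓ i ∣ n → ℓ i ∣ N) : n ∣ D * N := by
  classical
  rw [← Finset.prod_filter_mul_prod_filter_not s (fun i => ℓ i ∣ n), ← mul_assoc] at h
  have hcop : n.Coprime (∏ i ∈ s with ¬ ℓ i ∣ n, ℓ i) := by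
    refine Nat.Coprime.prod_right fun i hi => ?_
    exact ((Nat.Prime.coprime_iff_not_dvd (hℓ i)).2 (Finset.mem_filter.1 hi).2).symm
  refine (hcop.dvd_of_dvd_mul_right h).trans (mul_dvd_mul_left _ ?_)
  rw [← Finset.prod_image (f := fun p => p) (g := ℓ) hinj.injOn]
  refine Finset.prod_primes_dvd _ ?_ ?_
  · intro a ha
    obtain ⟨i, -, rfl⟩ := Finset.mem_image.1 ha
    exact (hℓ i).prime
  · intro a ha
    obtain ⟨i, hi, rfl⟩ := Finset.mem_image.1 ha
    exact hN i (Finset.mem_filter.1 hi).1 (Finset.mem_filter.1 hi).2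

/-- A torsion field with a sequence of roots of unity, each of which fails to be a power of the
corresponding prime exponent. -/
structure TwistData (K : Type*) [Field K] where
  /-- the prime exponents -/
  ℓ : ℕ → ℕ
  /-- the twisting roots of unity -/
  ξ : ℕ → Kˣ
  exists_pow_eq_one : ∀ x : Kˣ, ∃ T : ℕ, 0 < T ∧ x ^ T = 1
  prime : ∀ k, (ℓ k).Prime
  injective : Function.Injective ℓ
  cast_ne_zero : ∀ k, (ℓ k : K) ≠ 0
  exists_pow_eq : ∀ j k, j ≠ k → ∃ y, y ^ ℓ j = ξ k
  pow_ne : ∀ k y, y ^ ℓ k ≠ ξ k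

namespace TwistData

variable {K Ω : Type*} [Field K] [Field Ω] [Algebra K Ω] (d : TwistData K)

/-- The sequence `s` is a tower of twisted roots: `s m = ξ m * s (m + 1) ^ ℓ m`, with each `s m`
transcendental. -/
structure Tower (s : ℕ → Ω) : Prop where
  eq : ∀ m, s m = algebraMap K Ω (d.ξ m) * s (m + 1) ^ d.ℓ m
  transcendental : ∀ m, Transcendental K (s m)

variable {d} {s : ℕ → Ω}

lemma exists_tower [IsAlgClosed Ω] {t : Ω} (ht : Transcendental K t) :
    ∃ s : ℕ → Ω, s 0 = t ∧ d.Tower s := by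
  have hroot (m : ℕ) (x : Ω) : ∃ y, x = algebraMap K Ω (d.ξ m) * y ^ d.ℓ m := by
    obtain ⟨y, hy⟩ := IsAlgClosed.exists_pow_nat_eq ((algebraMap K Ω (d.ξ m))⁻¹ * x)
      (d.prime m).pos
    exact ⟨y, by rw [hy, mul_inv_cancel_left₀ (by simp)]⟩
  choose next hnext using hroot
  refine ⟨fun m => Nat.rec t next m, rfl, fun m => hnext m _, fun m => ?_⟩
  induction m with
  | zero => exact ht
  | succ m ih =>
    intro halg
    refine ih ?_
    change IsAlgebraic K (Nat.rec t next m : Ω)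
    rw [hnext m (Nat.rec t next m)]
    exact (isAlgebraic_algebraMap _).mul (halg.pow _)

lemma Tower.eq_of_le (hs : d.Tower s) {m M : ℕ} (h : m ≤ M) :
    ∃ η : Kˣ, s m = algebraMap K Ω η * s M ^ ∏ k ∈ Finset.Ico m M, d.ℓ k ∧
      (∀ k, M ≤ k → ∃ y, y ^ d.ℓ k = η) ∧
      ∀ k, m ≤ k → k < M → ∃ P y, P.Coprime (d.ℓ k) ∧ η = d.ξ k ^ P * y ^ d.ℓ k := by
  induction M, h using Nat.le_induction with
  | base => exact ⟨1, by simp, fun k _ => ⟨1, by simp⟩, fun k h₁ h₂ => by omega⟩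
  | succ M hM ih =>
    obtain ⟨η, h₁, h₂, h₃⟩ := ih
    refine ⟨η * d.ξ M ^ ∏ k ∈ Finset.Ico m M, d.ℓ k, ?_, ?_, ?_⟩
    · rw [h₁, hs.eq M, Finset.prod_Ico_succ_top hM]
      rw [Units.val_mul, Units.val_pow_eq_pow_val, map_mul, map_pow]
      ring
    · intro k hk
      obtain ⟨y, hy⟩ := h₂ k (by omega)
      obtain ⟨z, hz⟩ := d.exists_pow_eq k M (by omega)
      refine ⟨y * z ^ ∏ k ∈ Finset.Ico m M, d.ℓ k, ?_⟩
      rw [mul_pow, hy, pow_right_comm, hz]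
    · intro k hmk hkM
      rcases Nat.lt_succ_iff_lt_or_eq.1 hkM with hlt | rfl
      · obtain ⟨P, y, hP, hy⟩ := h₃ k hmk hlt
        obtain ⟨z, hz⟩ := d.exists_pow_eq k M (by omega)
        refine ⟨P, y * z ^ ∏ k ∈ Finset.Ico m M, d.ℓ k, hP, ?_⟩
        rw [mul_pow, hy, pow_right_comm z, hz, mul_assoc]
      · obtain ⟨y, hy⟩ := h₂ k le_rfl
        refine ⟨∏ k ∈ Finset.Ico m k, d.ℓ k, y, ?_, by rw [hy, mul_comm]⟩
        refine Nat.Coprime.prod_left fun j hj => ?_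
        refine (Nat.coprime_primes (d.prime _) (d.prime _)).2 fun h => ?_
        have := d.injective h
        simp at hj
        omega

open IntermediateField

/-- The union of the rational function fields generated by the members of a tower. -/
noncomputable def unionField (K : Type*) {Ω : Type*} [Field K] [Field Ω] [Algebra K Ω]
    (s : ℕ → Ω) : IntermediateField K Ω :=
  ⨆ m, K⟮s m⟯

lemma Tower.monotone (hs : d.Tower s) : Monotone fun m => K⟮s m⟯ := by
  refine monotone_nat_of_le_succ fun m => ?_
  rw [adjoin_simple_le_iff, hs.eq m]
  exact mul_mem (IntermediateField.algebraMap_mem _ _) (pow_mem (mem_adjoin_simple_self K _) _)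

lemma Tower.mem_unionField_iff (hs : d.Tower s) {x : Ω} :
    x ∈ unionField K s ↔ ∃ m, x ∈ K⟮s m⟯ := by
  rw [unionField, ← SetLike.mem_coe, coe_iSup_of_directed hs.monotone.directed_le]
  simp

lemma Tower.self_mem (hs : d.Tower s) (m : ℕ) : s m ∈ unionField K s :=
  hs.mem_unionField_iff.2 ⟨m, mem_adjoin_simple_self K _⟩

lemma Tower.exists_pow_eq (hs : d.Tower s) (k : ℕ) :
    ∃ η : Kˣ, ∃ g ∈ unionField K s, g ^ d.ℓ k = algebraMap K Ω η * s 0 := by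
  obtain ⟨η, h, -, -⟩ := hs.eq_of_le (Nat.zero_le (k + 1))
  refine ⟨η⁻¹, s (k + 1) ^ ∏ j ∈ Finset.range k, d.ℓ j, pow_mem (hs.self_mem _) _, ?_⟩
  rw [h, ← mul_assoc, ← map_mul, Units.inv_mul, map_one, one_mul, ← pow_mul,
    Nat.Ico_zero_eq_range, Finset.prod_range_succ]

/-- An element of some level which is an `n`-th power in the union field yields a polynomial
identity. -/
lemma Tower.exists_polynomial_identity (hs : d.Tower s) {m n : ℕ} {f g : K[X]} (hf : f ≠ 0)
    (hg : g ≠ 0) (hn : n ≠ 0) {h : Ω} (hmem : h ∈ unionField K s)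
    (heq : h ^ n = aeval (s m) f / aeval (s m) g) :
    ∃ M, m ≤ M ∧ ∃ η : Kˣ, ∃ q r : K[X], q ≠ 0 ∧ r ≠ 0 ∧
      f.comp (C (η : K) * X ^ ∏ k ∈ Finset.Ico m M, d.ℓ k) * q ^ n =
        g.comp (C (η : K) * X ^ ∏ k ∈ Finset.Ico m M, d.ℓ k) * r ^ n ∧
      ∀ k, m ≤ k → k < M → ∃ P y, P.Coprime (d.ℓ k) ∧ η = d.ξ k ^ P * y ^ d.ℓ k := by
  obtain ⟨M₀, hM₀⟩ := hs.mem_unionField_iff.1 hmem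
  have hM : h ∈ K⟮s (max m M₀)⟯ := hs.monotone (le_max_right _ _) hM₀
  generalize hMdef : max m M₀ = M at hM
  have hmM : m ≤ M := hMdef ▸ le_max_left _ _
  obtain ⟨r, q, hrq⟩ := (mem_adjoin_simple_iff K h).1 hM
  obtain ⟨η, hη, -, hη'⟩ := hs.eq_of_le hmM
  have inj (j : ℕ) {p : K[X]} : aeval (s j) p = 0 ↔ p = 0 :=
    map_eq_zero_iff _ (transcendental_iff_injective.1 (hs.transcendental j))
  have hf' := (inj m).not.2 hf
  have hg' := (inj m).not.2 hg
  have hh : h ≠ 0 := by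
    rintro rfl
    rw [zero_pow hn] at heq
    exact div_ne_zero hf' hg' heq.symm
  have hr : aeval (s M) r ≠ 0 := by rintro h0; simp [hrq, h0] at hh
  have hq : aeval (s M) q ≠ 0 := by rintro h0; simp [hrq, h0] at hh
  refine ⟨M, hmM, η, q, r, (inj M).not.1 hq, (inj M).not.1 hr, ?_, hη'⟩
  apply transcendental_iff_injective.1 (hs.transcendental M)
  have hcomp (p : K[X]) : aeval (s M) (p.comp (C (η : K) * X ^ ∏ k ∈ Finset.Ico m M, d.ℓ k))
      = aeval (s m) p := by
    rw [aeval_comp]; simp [hη]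
  rw [map_mul, map_mul, hcomp, hcomp, map_pow, map_pow]
  rw [hrq, div_pow, div_eq_div_iff (pow_ne_zero _ hq) hg'] at heq
  linear_combination -heq

lemma Tower.le_rootMultiplicity (hs : d.Tower s) {m n : ℕ} {f g : K[X]} (hf : f ≠ 0)
    (hg : g ≠ 0) (hfg : IsCoprime f g) {β : AlgebraicClosure K} (hβ : β ≠ 0)
    (hfβ : aeval β f = 0) (hn : n ≠ 0) {h : Ω} (hmem : h ∈ unionField K s)
    (heq : h ^ n = aeval (s m) f / aeval (s m) g) :
    n ≤ (f.map (algebraMap K (AlgebraicClosure K))).rootMultiplicity β := by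
  obtain ⟨M, hM, η, q, r, hq, hr, hid, -⟩ := hs.exists_polynomial_identity hf hg hn hmem heq
  have hinj := (algebraMap K (AlgebraicClosure K)).injective
  have hid' := congrArg (Polynomial.map (algebraMap K (AlgebraicClosure K))) hid
  simp only [Polynomial.map_mul, Polynomial.map_pow, map_comp, map_C, map_X] at hid'
  refine le_rootMultiplicity_of_comp_mul_pow_eq ?_ ?_ ((Polynomial.map_ne_zero_iff hinj).2 hf)
    ((Polynomial.map_ne_zero_iff hinj).2 hq) ((Polynomial.map_ne_zero_iff hinj).2 hr) hβ ?_ ?_ hid'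
  · rw [← map_natCast (algebraMap K (AlgebraicClosure K)), Ne, map_eq_zero, Nat.cast_prod,
      Finset.prod_eq_zero_iff]
    rintro ⟨k, -, hk⟩
    exact d.cast_ne_zero k hk
  · simp
  · rwa [IsRoot, eval_map_algebraMap]
  · rw [IsRoot, eval_map_algebraMap]
    intro hgβ
    obtain ⟨a, b, hab⟩ := hfg
    simpa [hfβ, hgβ] using congrArg (aeval β) hab

lemma Tower.le_of_pow_eq_monomial (hs : d.Tower s) {m n D T : ℕ} {c : Kˣ} (hD : 0 < D)
    (hT : 0 < T) (hc : c ^ T = 1) (hn : n ≠ 0) {h : Ω} (hmem : h ∈ unionField K s)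
    (heq : h ^ n = algebraMap K Ω c * s m ^ D) : n ≤ D * (D * T) := by
  obtain ⟨M, hM, η, q, r, hq, hr, hid, hη⟩ := hs.exists_polynomial_identity (m := m)
    (f := C (c : K) * X ^ D) (g := 1) (by simp) one_ne_zero hn hmem (by simpa using heq)
  have hdeg := congrArg natDegree hid
  have hlc := congrArg leadingCoeff hid
  have hcomp : (C (c : K) * X ^ D).comp (C (η : K) * X ^ ∏ k ∈ Finset.Ico m M, d.ℓ k)
      = C ((c : K) * η ^ D) * X ^ (D * ∏ k ∈ Finset.Ico m M, d.ℓ k) := by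
    simp only [mul_comp, C_comp, pow_comp, X_comp, C_mul, C_pow]
    ring
  rw [hcomp, one_comp, one_mul, natDegree_mul (by simp) (pow_ne_zero _ hq),
    natDegree_C_mul_X_pow _ _ (by simp), natDegree_pow, natDegree_pow] at hdeg
  rw [hcomp, one_comp, one_mul, leadingCoeff_mul, leadingCoeff_C_mul_X_pow, leadingCoeff_pow,
    leadingCoeff_pow] at hlc
  have hdvd : n ∣ D * ∏ k ∈ Finset.Ico m M, d.ℓ k :=
    (Nat.dvd_add_left (dvd_mul_right _ _)).1 ⟨_, hdeg⟩
  have hpow : ∃ y : Kˣ, y ^ n = c * η ^ D := by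
    refine ⟨Units.mk0 _ (leadingCoeff_ne_zero.2 hr) / Units.mk0 _ (leadingCoeff_ne_zero.2 hq), ?_⟩
    rw [div_pow, div_eq_iff_eq_mul]
    ext
    simpa using hlc.symm
  refine Nat.le_of_dvd (by positivity)
    (dvd_mul_of_dvd_mul_prod_primes d.prime d.injective _ hdvd fun k hk hkn => ?_)
  by_contra hkD
  rw [(d.prime k).dvd_mul, not_or] at hkD
  rw [Finset.mem_Ico] at hk
  obtain ⟨P, y, hP, rfl⟩ := hη k hk.1 hk.2
  obtain ⟨z, hz⟩ := hpow
  obtain ⟨n', rfl⟩ := hkn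
  obtain ⟨w, rfl⟩ := exists_pow_eq_of_coprime hc (((d.prime k).coprime_iff_not_dvd).2 hkD.2)
  have hPD : (P * D).Coprime (d.ℓ k) :=
    hP.mul_left (((d.prime k).coprime_iff_not_dvd).2 hkD.1).symm
  obtain ⟨v, hv⟩ := exists_pow_eq_of_pow_eq_pow (x := d.ξ k) (y := z ^ n' / (w * y ^ D)) hPD (by
    rw [div_pow, eq_div_iff_mul_eq', ← pow_mul, mul_comm n', hz, mul_pow, mul_pow, pow_mul,
      pow_right_comm y, mul_left_comm])
  exact d.pow_ne k v hv

/-- The bound on exponents for a quotient of coprime polynomials, up to inversion. -/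
lemma Tower.exists_bound (hs : d.Tower s) {b : Ω} (hb : b ∈ unionField K s) (hb0 : b ≠ 0)
    (htors : ∀ n : ℕ, 0 < n → b ^ n ≠ 1) :
    ∃ B : ℕ, ∀ n : ℕ, 0 < n → ∀ h ∈ unionField K s, h ^ n = b → n ≤ B := by
  classical
  obtain ⟨m, hm⟩ := hs.mem_unionField_iff.1 hb
  obtain ⟨f₀, g₀, rfl⟩ := (mem_adjoin_simple_iff K b).1 hm
  obtain ⟨f, g, hf₀, hg₀, hfg⟩ := extract_gcd f₀ g₀
  rw [gcd_isUnit_iff] at hfg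
  generalize gcd f₀ g₀ = γ at hf₀ hg₀
  have hg0 : aeval (s m) g₀ ≠ 0 := by rintro h0; simp [h0] at hb0
  have hquot : aeval (s m) f₀ / aeval (s m) g₀ = aeval (s m) f / aeval (s m) g := by
    rw [hg₀, map_mul] at hg0
    rw [hf₀, hg₀, map_mul, map_mul]
    exact mul_div_mul_left _ _ (left_ne_zero_of_mul hg0)
  rw [hquot] at hb0 htors ⊢
  have hf : f ≠ 0 := by rintro rfl; simp at hb0
  have hg : g ≠ 0 := by rintro rfl; simp at hb0
  rcases eq_monomial_or_exists_root (k := AlgebraicClosure K) hf with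
    ⟨c, i, hc, rfl⟩ | ⟨β, hβ, hfβ⟩
  swap
  · exact ⟨_, fun n hn h hmem heq => hs.le_rootMultiplicity hf hg hfg hβ hfβ hn.ne' hmem heq⟩
  rcases eq_monomial_or_exists_root (k := AlgebraicClosure K) hg with
    ⟨c', j, hc', rfl⟩ | ⟨β, hβ, hgβ⟩
  swap
  · exact ⟨_, fun n hn h hmem heq => hs.le_rootMultiplicity hg hf hfg.symm hβ hgβ hn.ne'
      (inv_mem hmem) (by rw [inv_pow, heq, inv_div])⟩
  have hsm : s m ≠ 0 := fun h0 => hs.transcendental m (h0 ▸ isAlgebraic_zero)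
  lift c to Kˣ using hc.isUnit
  lift c' to Kˣ using hc'.isUnit
  obtain ⟨T, hT, hcT⟩ := d.exists_pow_eq_one (c / c')
  have hcT' : (c' / c) ^ T = 1 := by rw [← inv_div, inv_pow, hcT, inv_one]
  have hac (u : Kˣ) : algebraMap K Ω u ≠ 0 := by simp
  simp only [map_mul, aeval_C, map_pow, aeval_X] at htors ⊢
  rcases lt_trichotomy i j with hij | rfl | hij
  · refine ⟨_, fun n hn h hmem heq => hs.le_of_pow_eq_monomial (m := m) (D := j - i)
      (by omega) hT hcT' hn.ne' (inv_mem hmem) ?_⟩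
    obtain ⟨D, rfl⟩ := Nat.exists_eq_add_of_lt hij
    rw [inv_pow, heq, show i + D + 1 - i = D + 1 by omega]
    simp only [Units.val_div_eq_div_val, map_div₀]
    have := hac c; have := hac c'
    field_simp
    ring
  · exfalso
    refine htors T hT ?_
    rw [mul_div_mul_right _ _ (pow_ne_zero _ hsm), ← map_div₀, ← Units.val_div_eq_div_val,
      ← map_pow, ← Units.val_pow_eq_pow_val, hcT]
    simp
  · refine ⟨_, fun n hn h hmem heq => hs.le_of_pow_eq_monomial (m := m) (D := i - j)
      (by omega) hT hcT hn.ne' hmem ?_⟩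
    obtain ⟨D, rfl⟩ := Nat.exists_eq_add_of_lt hij
    rw [heq, show j + D + 1 - j = D + 1 by omega]
    simp only [Units.val_div_eq_div_val, map_div₀]
    have := hac c; have := hac c'
    field_simp
    ring

lemma Tower.rootlessField (hs : d.Tower s) : RootlessField (unionField K s) := by
  intro b hb0 htors
  obtain ⟨B, hB⟩ := hs.exists_bound b.2 (by simpa using hb0)
    fun n hn h => htors ⟨n, hn, Subtype.ext (by simpa using h)⟩
  refine (Set.finite_Iic B).subset ?_
  rintro n ⟨hn, x, hx⟩
  exact hB n hn x x.2 (by rw [← hx]; simp)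

lemma Tower.not_rootlessModtorField (hs : d.Tower s) :
    ¬ RootlessModtorField (unionField K s) := by
  intro hF
  have htr := hs.transcendental 0
  have h0 : s 0 ≠ 0 := fun h => htr (h ▸ isAlgebraic_zero)
  have hfin := hF ⟨s 0, hs.self_mem 0⟩ (fun h => h0 (congrArg Subtype.val h)) (by
    rintro ⟨n, hn, h⟩
    have h' : s 0 ^ n = 1 := congrArg Subtype.val h
    exact htr.pow hn (h' ▸ isAlgebraic_one))
  refine (Set.infinite_range_of_injective d.injective) (hfin.subset ?_)
  rintro _ ⟨k, rfl⟩
  obtain ⟨η, g, hg, heq⟩ := hs.exists_pow_eq k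
  obtain ⟨T, hT, hηT⟩ := d.exists_pow_eq_one η
  refine ⟨(d.prime k).pos, algebraMap K _ η, ⟨g, hg⟩, ⟨T, hT, ?_⟩, Subtype.ext heq⟩
  rw [← map_pow, ← Units.val_pow_eq_pow_val, hηT]
  simp

end TwistData

lemma pow_two_pow_mul_eq_self {M : Type*} [Monoid M] {x : M} {a : ℕ} (h : x ^ 2 ^ a = x)
    (b : ℕ) : x ^ 2 ^ (a * b) = x := by
  induction b with
  | zero => simp
  | succ b ih => rw [mul_add, mul_one, pow_add, pow_mul, ih, h]

/-- The union of the finite fields with `2 ^ 2 ^ m` elements. -/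
def quadraticClosureTwo : Subfield (AlgebraicClosure (ZMod 2)) where
  carrier := {x | ∃ m : ℕ, x ^ 2 ^ 2 ^ m = x}
  zero_mem' := ⟨0, by simp⟩
  one_mem' := ⟨0, by simp⟩
  add_mem' := by
    rintro x y ⟨m, hx⟩ ⟨n, hy⟩
    refine ⟨m + n, ?_⟩
    rw [add_pow_char_pow, pow_add, pow_two_pow_mul_eq_self hx, mul_comm,
      pow_two_pow_mul_eq_self hy]
  mul_mem' := by
    rintro x y ⟨m, hx⟩ ⟨n, hy⟩
    refine ⟨m + n, ?_⟩
    rw [mul_pow, pow_add, pow_two_pow_mul_eq_self hx, mul_comm (2 ^ m),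
      pow_two_pow_mul_eq_self hy]
  neg_mem' := by
    rintro x ⟨m, hx⟩
    exact ⟨m, by rw [CharTwo.neg_eq, hx]⟩
  inv_mem' := by
    rintro x ⟨m, hx⟩
    exact ⟨m, by rw [inv_pow, hx]⟩

namespace quadraticClosureTwo

lemma two_pow_two_pow_eq (m : ℕ) : 2 ^ 2 ^ m = ∏ i ∈ Finset.range m, i.fermatNumber + 1 := by
  have := Nat.fermatNumber_eq_prod_add_two m
  rw [Nat.fermatNumber] at this
  omega

lemma exists_pow_prod_fermatNumber_eq_one (x : quadraticClosureTwoˣ) :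
    ∃ m : ℕ, x ^ ∏ i ∈ Finset.range m, i.fermatNumber = 1 := by
  obtain ⟨m, hm⟩ := x.1.2
  refine ⟨m, ?_⟩
  rw [two_pow_two_pow_eq] at hm
  have hx : x ^ (∏ i ∈ Finset.range m, i.fermatNumber + 1) = x := by
    ext
    simpa using hm
  rwa [pow_succ, mul_eq_right] at hx

lemma exists_isPrimitiveRoot_fermatNumber (k : ℕ) :
    ∃ ξ : quadraticClosureTwoˣ, IsPrimitiveRoot ξ k.fermatNumber := by
  have : NeZero (k.fermatNumber : AlgebraicClosure (ZMod 2)) := ⟨by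
    rw [Ne, CharP.cast_eq_zero_iff _ 2, ← even_iff_two_dvd, Nat.not_even_iff_odd]
    exact Nat.odd_fermatNumber k⟩
  obtain ⟨ζ, hζ⟩ :=
    HasEnoughRootsOfUnity.exists_primitiveRoot (AlgebraicClosure (ZMod 2)) k.fermatNumber
  have hmem : ζ ∈ quadraticClosureTwo := by
    refine ⟨k + 1, ?_⟩
    rw [two_pow_two_pow_eq, Finset.prod_range_succ, pow_succ, mul_comm _ k.fermatNumber, pow_mul,
      hζ.pow_eq_one, one_pow, one_mul]
  have hζ' : IsPrimitiveRoot (⟨ζ, hmem⟩ : quadraticClosureTwo) k.fermatNumber :=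
    IsPrimitiveRoot.of_map_of_injective (f := quadraticClosureTwo.subtype) hζ
      Subtype.val_injective
  have hne := Nat.three_le_fermatNumber k
  exact ⟨(hζ'.isUnit (by omega)).unit, hζ'.isUnit_unit (by omega)⟩

lemma coprime_minFac_fermatNumber {j k : ℕ} (h : j ≠ k) :
    j.fermatNumber.minFac.Coprime k.fermatNumber :=
  (Nat.coprime_fermatNumber_fermatNumber h).coprime_dvd_left (Nat.minFac_dvd _)

/-- A primitive root of unity of order a Fermat number is not a power with exponent a prime factor
of that number. -/
lemma pow_minFac_ne {k : ℕ} {ξ : quadraticClosureTwoˣ} (hξ : IsPrimitiveRoot ξ k.fermatNumber)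
    (y : quadraticClosureTwoˣ) : y ^ k.fermatNumber.minFac ≠ ξ := by
  intro hy
  obtain ⟨m, hm⟩ := exists_pow_prod_fermatNumber_eq_one y
  obtain ⟨c, hc⟩ := Nat.minFac_dvd k.fermatNumber
  have h3 := Nat.three_le_fermatNumber k
  have hprime := Nat.minFac_prime (Nat.fermatNumber_ne_one k)
  generalize k.fermatNumber.minFac = p at *
  have hcop : k.fermatNumber.Coprime (∏ i ∈ (Finset.range m).erase k, i.fermatNumber) :=
    Nat.Coprime.prod_right fun i hi =>
      Nat.coprime_fermatNumber_fermatNumber (Finset.ne_of_mem_erase hi).symm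
  have hdvd : ∏ i ∈ Finset.range m, i.fermatNumber ∣
      k.fermatNumber * ∏ i ∈ (Finset.range m).erase k, i.fermatNumber := by
    by_cases hk : k ∈ Finset.range m
    · rw [Finset.mul_prod_erase _ _ hk]
    · rw [Finset.erase_eq_of_notMem hk]
      exact dvd_mul_left _ _
  have hone : ξ ^ (c * ∏ i ∈ (Finset.range m).erase k, i.fermatNumber) = 1 := by
    rw [← hy, ← pow_mul, ← mul_assoc, ← hc]
    exact orderOf_dvd_iff_pow_eq_one.1 ((orderOf_dvd_of_pow_eq_one hm).trans hdvd)
  have hlt := hcop.dvd_of_dvd_mul_right (hξ.dvd_of_pow_eq_one _ hone)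
  have hc0 : 0 < c := by
    rcases Nat.eq_zero_or_pos c with rfl | h
    · omega
    · exact h
  have := Nat.le_of_dvd hc0 hlt
  have := hprime.two_le
  nlinarith

/-- The twist given by the smallest prime factors of Fermat numbers. -/
noncomputable def twistData : TwistData quadraticClosureTwo where
  ℓ k := k.fermatNumber.minFac
  ξ k := (exists_isPrimitiveRoot_fermatNumber k).choose
  exists_pow_eq_one x := by
    obtain ⟨m, hm⟩ := exists_pow_prod_fermatNumber_eq_one x
    exact ⟨_, Finset.prod_pos fun i _ => by have := Nat.three_le_fermatNumber i; omega, hm⟩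
  prime k := Nat.minFac_prime (Nat.fermatNumber_ne_one k)
  injective := by
    intro j k h
    by_contra hjk
    have hcop := coprime_minFac_fermatNumber hjk
    refine (Nat.minFac_prime (Nat.fermatNumber_ne_one k)).one_lt.ne' ?_
    exact Nat.eq_one_of_dvd_coprimes hcop (dvd_of_eq h.symm) (Nat.minFac_dvd _)
  cast_ne_zero k h := by
    have h' := congrArg (algebraMap quadraticClosureTwo (AlgebraicClosure (ZMod 2))) h
    rw [map_natCast, map_zero, CharP.cast_eq_zero_iff _ 2] at h'
    exact Nat.not_even_iff_odd.2 (Nat.odd_fermatNumber k)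
      (even_iff_two_dvd.2 (h'.trans (Nat.minFac_dvd _)))
  exists_pow_eq j k hjk := exists_pow_eq_of_coprime
    (exists_isPrimitiveRoot_fermatNumber k).choose_spec.pow_eq_one (coprime_minFac_fermatNumber hjk)
  pow_ne k := pow_minFac_ne (exists_isPrimitiveRoot_fermatNumber k).choose_spec

end quadraticClosureTwo

/-- There is a field that is rootless but not rootless modtor. -/
theorem stmt19 :
    ∃ (F : Type) (_ : Field F), RootlessField F ∧ ¬ RootlessModtorField F := by
  have hX : Transcendental quadraticClosureTwo
      (algebraMap (RatFunc quadraticClosureTwo) (AlgebraicClosure (RatFunc quadraticClosureTwo))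
        RatFunc.X) :=
    (transcendental_algebraMap_iff (FaithfulSMul.algebraMap_injective _ _)).2 RatFunc.transcendental_X
  obtain ⟨s, -, hs⟩ := quadraticClosureTwo.twistData.exists_tower hX
  exact ⟨_, _, hs.rootlessField, hs.not_rootlessModtorField⟩
end
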